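/- arXiv:1806.02100 — 11 statements merged into one kernel-verified Lean document; each statement's English description precedes it below -/
import Mathlib

section
/- Let f be a surjective isometry of the Gromov–Hausdorff space onto itself, and suppose that for some integers p, q ≥ 2 and some real t > 0 one has f(tΔ_p) = tΔ_q. Then f(sΔ_p) = sΔ_q for every real s > 0. -/
/-- The metric on `Fin n` in which every nonzero distance equals `t`. -/
noncomputable def simplexMetric (n : ℕ) (t : ℝ) (ht : 0 < t) : MetricSpace (Fin n) where
  dist i j := if i = j then 0 else t
  dist_self i := by simp
  dist_comm i j := by by_cases h : i = j <;> simp [h, Ne.symm, eq_comm]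
  dist_triangle i j k := by
    by_cases h1 : i = k <;> by_cases h2 : i = j <;> by_cases h3 : j = k <;>
      simp_all <;> linarith
  eq_of_dist_eq_zero := by
    intro i j h
    by_cases hij : i = j
    · exact hij
    · simp [hij] at h; exact absurd h (ne_of_gt ht)

/-- The point of the Gromov–Hausdorff space corresponding to the simplex `tΔ_n`,
the `n`-point metric space all of whose nonzero distances equal `t`. -/
noncomputable def simplexGH (n : ℕ) (hn : 0 < n) (t : ℝ) (ht : 0 < t) :
    GromovHausdorff.GHSpace :=
  letI := simplexMetric n t ht
  haveI : Nonempty (Fin n) := ⟨⟨0, hn⟩⟩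
  GromovHausdorff.toGHSpace (Fin n)

/-- The class `Δ₁` of the one-point metric space. -/
noncomputable def onePointGH : GromovHausdorff.GHSpace := simplexGH 1 one_pos 1 one_pos

/-- The diameter of (a representative of) a point of the Gromov–Hausdorff space. -/
noncomputable def ghDiam (X : GromovHausdorff.GHSpace) : ℝ :=
  Metric.diam (Set.univ : Set X.Rep)

open GromovHausdorff Metric Set

section Correspondences

universe u v

variable {X : Type u} [MetricSpace X] [CompactSpace X] [Nonempty X]
  {Y : Type v} [MetricSpace Y] [CompactSpace Y] [Nonempty Y]

/-- A correspondence of distortion at most `2 * r` bounds the Gromov–Hausdorff distance by `r`. -/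
theorem ghDist_le_of_correspondence {r : ℝ} (R : X → Y → Prop)
    (hl : ∀ x, ∃ y, R x y) (hr : ∀ y, ∃ x, R x y)
    (h : ∀ x y x' y', R x y → R x' y' → |dist x x' - dist y y'| ≤ 2 * r) :
    ghDist X Y ≤ r := by
  obtain ⟨x₀⟩ := ‹Nonempty X›
  obtain ⟨y₀, h₀⟩ := hl x₀
  have : Nonempty X := ⟨x₀⟩
  have r0 : 0 ≤ r := by
    have := (abs_nonneg _).trans (h _ _ _ _ h₀ h₀)
    linarith
  refine le_of_forall_pos_le_add fun δ δ0 => ?_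
  let Z := {p : X × Y // R p.1 p.2}
  have : Nonempty Z := ⟨⟨(x₀, y₀), h₀⟩⟩
  let Φ : Z → X := fun p => p.1.1
  let Ψ : Z → Y := fun p => p.1.2
  let _ : MetricSpace (X ⊕ Y) := glueMetricApprox Φ Ψ (r + δ) (by linarith)
    fun p q => (h _ _ _ _ p.2 q.2).trans (by linarith)
  have Il : Isometry (Sum.inl : X → X ⊕ Y) := Isometry.of_dist_eq fun x y => rfl
  have Ir : Isometry (Sum.inr : Y → X ⊕ Y) := Isometry.of_dist_eq fun x y => rfl
  have glued : ∀ x y, R x y → dist (Sum.inl x : X ⊕ Y) (Sum.inr y) = r + δ := fun x y hxy =>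
    glueDist_glued_points Φ Ψ (r + δ) ⟨(x, y), hxy⟩
  refine (ghDist_le_hausdorffDist Il Ir).trans
    (hausdorffDist_le_of_mem_dist (by linarith) ?_ ?_)
  · rintro _ ⟨x, rfl⟩
    obtain ⟨y, hy⟩ := hl x
    exact ⟨_, mem_range_self y, (glued x y hy).le⟩
  · rintro _ ⟨y, rfl⟩
    obtain ⟨x, hx⟩ := hr y
    exact ⟨_, mem_range_self x, (dist_comm _ _).trans_le (glued x y hx).le⟩

theorem exists_correspondence_of_ghDist_le {r : ℝ} (h : ghDist X Y ≤ r) :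
    ∃ R : X → Y → Prop, (∀ x, ∃ y, R x y) ∧ (∀ y, ∃ x, R x y) ∧
      ∀ x y x' y', R x y → R x' y' → |dist x x' - dist y y'| ≤ 2 * r := by
  let l := optimalGHInjl X Y
  let m := optimalGHInjr X Y
  have Il : Isometry l := isometry_optimalGHInjl X Y
  have Ir : Isometry m := isometry_optimalGHInjr X Y
  have Cl : IsCompact (range l) := isCompact_range Il.continuous
  have Cr : IsCompact (range m) := isCompact_range Ir.continuous
  have hd : hausdorffDist (range l) (range m) ≤ r := hausdorffDist_optimal.trans_le h
  have fin : hausdorffEDist (range l) (range m) ≠ ⊤ :=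
    hausdorffEDist_ne_top_of_nonempty_of_bounded (range_nonempty _) (range_nonempty _)
      Cl.isBounded Cr.isBounded
  refine ⟨fun x y => dist (l x) (m y) ≤ r, fun x => ?_, fun y => ?_, fun x y x' y' h₁ h₂ => ?_⟩
  · obtain ⟨_, ⟨y, rfl⟩, hy⟩ := Cr.exists_infDist_eq_dist (range_nonempty _) (l x)
    exact ⟨y, hy.ge.trans <| (infDist_le_hausdorffDist_of_mem (mem_range_self x) fin).trans hd⟩
  · obtain ⟨_, ⟨x, rfl⟩, hx⟩ := Cl.exists_infDist_eq_dist (range_nonempty _) (m y)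
    rw [hausdorffDist_comm] at hd
    rw [hausdorffEDist_comm] at fin
    exact ⟨x, (dist_comm _ _).trans_le <| hx.ge.trans <|
      (infDist_le_hausdorffDist_of_mem (mem_range_self y) fin).trans hd⟩
  · rw [← Il.dist_eq x x', ← Ir.dist_eq y y', abs_le]
    have h₃ := dist_triangle4 (l x) (m y) (m y') (l x')
    have h₄ := dist_triangle4 (m y) (l x) (l x') (m y')
    rw [dist_comm (m y') (l x')] at h₃
    rw [dist_comm (m y) (l x)] at h₄
    constructor <;> linarith

end Correspondences

theorem dist_le_iff_exists_correspondence {A B : GHSpace} {r : ℝ} :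
    dist A B ≤ r ↔ ∃ R : A.Rep → B.Rep → Prop, (∀ x, ∃ y, R x y) ∧ (∀ y, ∃ x, R x y) ∧
      ∀ x y x' y', R x y → R x' y' → |dist x x' - dist y y'| ≤ 2 * r := by
  rw [dist_ghDist]
  exact ⟨exists_correspondence_of_ghDist_le,
    fun ⟨R, hl, hr, h⟩ => ghDist_le_of_correspondence R hl hr h⟩

theorem nonempty_isometryEquiv_rep (X : Type*) [MetricSpace X] [CompactSpace X] [Nonempty X] :
    Nonempty (X ≃ᵢ (toGHSpace X).Rep) :=
  toGHSpace_eq_toGHSpace_iff_isometryEquiv.1 (toGHSpace X).toGHSpace_rep.symm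

/-- A parametrization of the representative of `sΔ_n`. -/
theorem exists_simplexGH_equiv (n : ℕ) (hn : 0 < n) (s : ℝ) (hs : 0 < s) :
    ∃ e : Fin n ≃ (simplexGH n hn s hs).Rep, ∀ i j, dist (e i) (e j) = if i = j then 0 else s := by
  let _ := simplexMetric n s hs
  have : Nonempty (Fin n) := ⟨⟨0, hn⟩⟩
  obtain ⟨e⟩ := nonempty_isometryEquiv_rep (Fin n)
  exact ⟨e.toEquiv, fun i j => e.dist_eq i j⟩

theorem eq_simplexGH_of_equiv {Z : GHSpace} {n : ℕ} (hn : 0 < n) {s : ℝ} (hs : 0 < s)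
    (e : Fin n ≃ Z.Rep) (he : ∀ i j, i ≠ j → dist (e i) (e j) = s) :
    Z = simplexGH n hn s hs := by
  let _ := simplexMetric n s hs
  have : Nonempty (Fin n) := ⟨⟨0, hn⟩⟩
  rw [← Z.toGHSpace_rep]
  refine toGHSpace_eq_toGHSpace_iff_isometryEquiv.2
    ⟨(IsometryEquiv.mk' e e.symm e.apply_symm_apply (Isometry.of_dist_eq fun i j => ?_)).symm⟩
  change _ = if i = j then 0 else s
  split_ifs with h
  · rw [h, dist_self]
  · exact he i j h

theorem dist_simplexGH_rep {n : ℕ} {hn : 0 < n} {s : ℝ} {hs : 0 < s}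
    {x y : (simplexGH n hn s hs).Rep} (h : x ≠ y) : dist x y = s := by
  obtain ⟨e, he⟩ := exists_simplexGH_equiv n hn s hs
  obtain ⟨i, rfl⟩ := e.surjective x
  obtain ⟨j, rfl⟩ := e.surjective y
  rw [he, if_neg fun hij => h (congrArg e hij)]

instance : Subsingleton onePointGH.Rep := by
  obtain ⟨e, -⟩ := exists_simplexGH_equiv 1 one_pos 1 one_pos
  exact e.symm.subsingleton

theorem eq_onePointGH {Z : GHSpace} [Subsingleton Z.Rep] : Z = onePointGH := by
  obtain ⟨z⟩ : Nonempty Z.Rep := inferInstance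
  let e : Fin 1 ≃ Z.Rep := ⟨fun _ => z, fun _ => 0, fun _ => Subsingleton.elim _ _,
    fun _ => Subsingleton.elim _ _⟩
  exact eq_simplexGH_of_equiv _ _ e fun i j h => absurd (Subsingleton.elim i j) h

theorem dist_onePointGH_le_iff {A : GHSpace} {r : ℝ} :
    dist onePointGH A ≤ r ↔ ∀ x y : A.Rep, dist x y ≤ 2 * r := by
  rw [dist_le_iff_exists_correspondence]
  constructor
  · rintro ⟨R, -, hr, h⟩ x y
    obtain ⟨i, hi⟩ := hr x
    obtain ⟨j, hj⟩ := hr y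
    have := h _ _ _ _ hi hj
    rwa [Subsingleton.elim i j, dist_self, zero_sub, abs_neg, abs_of_nonneg dist_nonneg] at this
  · intro h
    obtain ⟨a⟩ : Nonempty A.Rep := inferInstance
    obtain ⟨p⟩ : Nonempty onePointGH.Rep := inferInstance
    refine ⟨fun _ _ => True, fun _ => ⟨a, trivial⟩, fun _ => ⟨p, trivial⟩, ?_⟩
    intro i x j y _ _
    rw [Subsingleton.elim i j, dist_self, zero_sub, abs_neg, abs_of_nonneg dist_nonneg]
    exact h x y

theorem dist_onePointGH_simplexGH {n : ℕ} (hn : 2 ≤ n) {hn' : 0 < n} {s : ℝ} {hs : 0 < s} :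
    dist onePointGH (simplexGH n hn' s hs) = s / 2 := by
  refine le_antisymm (dist_onePointGH_le_iff.2 fun x y => ?_) ?_
  · by_cases h : x = y
    · rw [h, dist_self]; linarith
    · rw [dist_simplexGH_rep h]; linarith
  · obtain ⟨e, he⟩ := exists_simplexGH_equiv n hn' s hs
    have := dist_onePointGH_le_iff.1 le_rfl (e ⟨0, hn'⟩) (e ⟨1, hn⟩)
    rw [he, if_neg (by simp)] at this
    linarith

theorem dist_simplexGH_simplexGH_le {n : ℕ} {hn : 0 < n} {s t : ℝ} {hs : 0 < s} {ht : 0 < t} :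
    dist (simplexGH n hn s hs) (simplexGH n hn t ht) ≤ |s - t| / 2 := by
  obtain ⟨e, he⟩ := exists_simplexGH_equiv n hn s hs
  obtain ⟨e', he'⟩ := exists_simplexGH_equiv n hn t ht
  refine dist_le_iff_exists_correspondence.2 ⟨fun x y => e.symm x = e'.symm y,
    fun x => ⟨e' (e.symm x), by simp⟩, fun y => ⟨e (e'.symm y), by simp⟩, ?_⟩
  intro x y x' y' h h'
  obtain ⟨i, rfl⟩ := e.surjective x
  obtain ⟨j, rfl⟩ := e.surjective x'
  simp only [Equiv.symm_apply_apply, Equiv.eq_symm_apply] at h h'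
  rw [← h, ← h', he, he']
  split_ifs
  · rw [sub_zero, abs_zero]
    positivity
  · linarith

theorem card_le_of_dist_simplexGH_lt {m n : ℕ} {hm : 0 < m} {hn : 0 < n} {s t : ℝ} {hs : 0 < s}
    {ht : 0 < t} (h : dist (simplexGH m hm s hs) (simplexGH n hn t ht) < s / 2) : m ≤ n := by
  obtain ⟨R, hl, -, hR⟩ := dist_le_iff_exists_correspondence.1 le_rfl
  obtain ⟨e, he⟩ := exists_simplexGH_equiv m hm s hs
  obtain ⟨e', -⟩ := exists_simplexGH_equiv n hn t ht
  choose g hg using hl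
  have : Function.Injective (e'.symm ∘ g ∘ e) := by
    intro i j hij
    by_contra hne
    have := hR _ _ _ _ (hg (e i)) (hg (e j))
    rw [he, if_neg hne, show g (e i) = g (e j) from e'.symm.injective hij, dist_self, sub_zero,
      abs_of_pos hs] at this
    linarith
  simpa using Fintype.card_le_of_injective _ this

theorem card_eq_of_dist_simplexGH_lt {m n : ℕ} {hm : 0 < m} {hn : 0 < n} {s t : ℝ} {hs : 0 < s}
    {ht : 0 < t} (h : dist (simplexGH m hm s hs) (simplexGH n hn t ht) < s / 2)
    (h' : dist (simplexGH m hm s hs) (simplexGH n hn t ht) < t / 2) : m = n :=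
  (card_le_of_dist_simplexGH_lt h).antisymm 
    (card_le_of_dist_simplexGH_lt ((dist_comm _ _).trans_lt h'))

/-- `Z` is centred for a family of points `C` if every two points of `C` within distance `ρ` of
`Z` are within distance `ρ` of each other. -/
def IsCentred (C : Set GHSpace) (Z : GHSpace) : Prop :=
  ∀ ρ : ℝ, ∀ U ∈ C, ∀ V ∈ C, dist Z U ≤ ρ → dist Z V ≤ ρ → dist U V ≤ ρ

theorem IsCentred.map {C : Set GHSpace} {Z : GHSpace} (h : IsCentred C Z) (f : GHSpace ≃ᵢ GHSpace)
    (hC : ∀ U ∈ C, f.symm U ∈ C) : IsCentred C (f Z) := by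
  intro ρ U hU V hV hZU hZV
  rw [← f.symm.dist_eq]
  refine h ρ _ (hC U hU) _ (hC V hV) ?_ ?_
  · rwa [← f.dist_eq, f.apply_symm_apply]
  · rwa [← f.dist_eq, f.apply_symm_apply]

theorem isCentred_of_forall_dist_le {C : Set GHSpace} {Z : GHSpace}
    (h : ∀ U ∈ C, ∀ i j : Z.Rep, i ≠ j → ∀ x y : U.Rep, dist x y ≤ dist i j) :
    IsCentred C Z := by
  intro ρ U hU V hV hZU hZV
  obtain ⟨R, hRl, hRr, hR⟩ := dist_le_iff_exists_correspondence.1 hZU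
  obtain ⟨S, hSl, hSr, hS⟩ := dist_le_iff_exists_correspondence.1 hZV
  refine dist_le_iff_exists_correspondence.2 ⟨fun x y => ∃ i, R i x ∧ S i y,
    fun x => ?_, fun y => ?_, ?_⟩
  · obtain ⟨i, hi⟩ := hRr x
    obtain ⟨y, hy⟩ := hSl i
    exact ⟨y, i, hi, hy⟩
  · obtain ⟨i, hi⟩ := hSr y
    obtain ⟨x, hx⟩ := hRl i
    exact ⟨x, i, hx, hi⟩
  · rintro x y x' y' ⟨i, hix, hiy⟩ ⟨j, hjx, hjy⟩
    have h₁ := abs_le.1 (hR _ _ _ _ hix hjx)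
    have h₂ := abs_le.1 (hS _ _ _ _ hiy hjy)
    rw [abs_le]
    by_cases hij : i = j
    · rw [hij, dist_self] at h₁ h₂
      constructor <;> linarith [dist_nonneg (x := x) (y := x'), dist_nonneg (x := y) (y := y')]
    · have h₃ := h U hU i j hij x x'
      have h₄ := h V hV i j hij y y'
      constructor <;> linarith

theorem isCentred_onePointGH : IsCentred univ onePointGH :=
  isCentred_of_forall_dist_le fun _ _ i j h => absurd (Subsingleton.elim i j) h

theorem isCentred_simplexGH {n : ℕ} {hn : 0 < n} {s : ℝ} {hs : 0 < s} :
    IsCentred (closedBall onePointGH (s / 2)) (simplexGH n hn s hs) := by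
  refine isCentred_of_forall_dist_le fun U hU i j hij x y => ?_
  rw [dist_simplexGH_rep hij]
  linarith [dist_onePointGH_le_iff.1 (mem_closedBall'.1 hU) x y]

/-- A finite `δ`-net of `Z`, with its distances transformed by `φ`. -/
theorem exists_net_with_transformed_dist (Z : GHSpace) (φ : ℝ → ℝ) (φ_zero : φ 0 = 0)
    (φ_pos : ∀ x, 0 < x → 0 < φ x)
    (φ_triangle : ∀ a b c, 0 ≤ a → 0 ≤ b → 0 ≤ c → c ≤ a + b → φ c ≤ φ a + φ b)
    {ε δ : ℝ} (hδ : 0 < δ)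
    (hφ : ∀ x y : Z.Rep, |dist x y - φ (dist x y)| ≤ 2 * ε) :
    ∃ (W : GHSpace) (z : W.Rep → Z.Rep), (∀ v w, dist v w = φ (dist (z v) (z w))) ∧
      (∀ x, ∃ w, dist x (z w) ≤ δ) ∧ dist Z W ≤ ε + δ := by
  obtain ⟨F, -, hF, hcover⟩ := finite_cover_balls_of_compact (X := Z.Rep) isCompact_univ hδ
  obtain ⟨k, z, z_inj, rfl⟩ := hF.fin_param
  have z_net : ∀ x, ∃ i, dist x (z i) ≤ δ := fun x => by
    have := hcover (mem_univ x)
    simp only [mem_iUnion, mem_range, exists_prop, exists_exists_eq_and, mem_ball] at this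
    exact this.imp fun i hi => hi.le
  have : Nonempty (Fin k) := by
    obtain ⟨x⟩ : Nonempty Z.Rep := inferInstance
    exact ⟨(z_net x).choose⟩
  let _ : MetricSpace (Fin k) :=
    { dist := fun i j => φ (dist (z i) (z j))
      dist_self := fun i => by rw [dist_self, φ_zero]
      dist_comm := fun i j => by rw [dist_comm]
      dist_triangle := fun i j l =>
        φ_triangle _ _ _ dist_nonneg dist_nonneg dist_nonneg (dist_triangle _ _ _)
      eq_of_dist_eq_zero := fun {i j} h => by
        by_contra hij
        exact (φ_pos _ (dist_pos.2 (z_inj.ne hij))).ne' h }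
  obtain ⟨e⟩ := nonempty_isometryEquiv_rep (Fin k)
  have he : ∀ v w, dist v w = φ (dist (z (e.symm v)) (z (e.symm w))) := fun v w =>
    (e.symm.dist_eq v w).symm
  have hnet : ∀ x, ∃ w, dist x (z (e.symm w)) ≤ δ := fun x => by
    obtain ⟨i, hi⟩ := z_net x
    exact ⟨e i, by rwa [e.symm_apply_apply]⟩
  refine ⟨toGHSpace (Fin k), z ∘ e.symm, he, hnet, dist_le_iff_exists_correspondence.2
    ⟨fun x w => dist x (z (e.symm w)) ≤ δ, hnet, fun w => ⟨z (e.symm w), by simp [hδ.le]⟩, ?_⟩⟩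
  intro x v x' w hv hw
  have h₁ := abs_le.1 (hφ (z (e.symm v)) (z (e.symm w)))
  rw [he, abs_le]
  have h₂ := dist_triangle4_right x x' (z (e.symm v)) (z (e.symm w))
  have h₃ := dist_triangle4_left x x' (z (e.symm v)) (z (e.symm w))
  constructor <;> linarith

theorem IsCentred.eq_onePointGH {Z : GHSpace} (h : IsCentred univ Z) : Z = onePointGH := by
  by_contra hne
  set D := dist onePointGH Z with hD
  have D_pos : 0 < D := dist_pos.2 (Ne.symm hne)
  obtain ⟨x, y, hxy⟩ : ∃ x y : Z.Rep, 2 * (D - D / 8) < dist x y := by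
    by_contra! H
    linarith [dist_onePointGH_le_iff.2 H]
  obtain ⟨W, z, hz, hnet, hW⟩ := exists_net_with_transformed_dist Z
    (fun r => if r ≤ 0 then 0 else r + D) (by simp) (fun r hr => by split_ifs <;> linarith)
    (fun a b c ha hb hc habc => by split_ifs <;> linarith)
    (ε := D / 2) (δ := D / 8) (by positivity)
    (fun x y => by
      have := dist_nonneg (x := x) (y := y)
      rw [abs_le]
      split_ifs <;> constructor <;> linarith)
  obtain ⟨v, hv⟩ := hnet x
  obtain ⟨w, hw⟩ := hnet y
  have h₁ := dist_onePointGH_le_iff.1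
    (h D _ (mem_univ _) W (mem_univ _) ((dist_comm _ _).trans_le hD.ge) (by linarith)) v w
  rw [hz] at h₁
  have h₂ := dist_triangle4_right x y (z v) (z w)
  split_ifs at h₁ <;> linarith

section Separation

variable {X : Type*} [MetricSpace X] [CompactSpace X]

theorem exists_tuple_not_separated {s : ℝ} (hs : 0 < s) :
    ∃ N, ¬∃ z : Fin N → X, ∀ i j, i ≠ j → s ≤ dist (z i) (z j) := by
  obtain ⟨F, -, hF, hcover⟩ := finite_cover_balls_of_compact (X := X) isCompact_univ (half_pos hs)
  obtain ⟨k, c, -, rfl⟩ := hF.fin_param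
  refine ⟨k + 1, fun ⟨z, hz⟩ => ?_⟩
  have : ∀ i, ∃ l, dist (z i) (c l) < s / 2 := fun i => by
    simpa using hcover (mem_univ (z i))
  choose g hg using this
  obtain ⟨i, j, hij, hgij⟩ := Fintype.exists_ne_map_eq_of_card_lt g (by simp)
  have h₁ := hg j
  rw [← hgij] at h₁
  linarith [hz i j hij, hg i, dist_triangle_right (z i) (z j) (c (g i))]

theorem exists_max_separation [Nonempty X] {N : ℕ} (hN : 2 ≤ N) :
    ∃ (z : Fin N → X) (a : ℝ), (∀ i j, i ≠ j → a ≤ dist (z i) (z j)) ∧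
      ∀ z' : Fin N → X, ∃ i j, i ≠ j ∧ dist (z' i) (z' j) ≤ a := by
  have hne : (Finset.univ : Finset (Fin N)).offDiag.Nonempty :=
    ⟨(⟨0, by omega⟩, ⟨1, by omega⟩), by simp⟩
  let g : (Fin N → X) → ℝ := fun z => Finset.univ.offDiag.inf' hne fun p => dist (z p.1) (z p.2)
  have hg : Continuous g := Continuous.finset_inf'_apply hne fun p _ => by fun_prop
  obtain ⟨z, -, hz⟩ := isCompact_univ.exists_isMaxOn univ_nonempty hg.continuousOn
  refine ⟨z, g z, fun i j hij => Finset.inf'_le (fun p : Fin N × Fin N => dist (z p.1) (z p.2))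
    (b := (i, j)) (by simpa using hij), fun z' => ?_⟩
  obtain ⟨p, hp, hgp⟩ := Finset.exists_mem_eq_inf' hne fun p => dist (z' p.1) (z' p.2)
  exact ⟨p.1, p.2, (Finset.mem_offDiag.1 hp).2.2, hgp.ge.trans (hz (mem_univ z'))⟩

end Separation

/-- In a centred space, the maximal separation of `N`-tuples cannot lie strictly between `0` and
the diameter. -/
theorem IsCentred.not_max_separation {Z : GHSpace} {s a : ℝ}
    (hZ : IsCentred (closedBall onePointGH (s / 2)) Z) (hd : dist onePointGH Z = s / 2)
    (ha : 0 < a) (has : a < s) {N : ℕ} (z : Fin N → Z.Rep)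
    (hz : ∀ i j, i ≠ j → a ≤ dist (z i) (z j))
    (hmax : ∀ z' : Fin N → Z.Rep, ∃ i j, i ≠ j ∧ dist (z' i) (z' j) ≤ a) : False := by
  have hs : 0 < s := ha.trans has
  have hle : ∀ x y : Z.Rep, dist x y ≤ s := fun x y => by
    linarith [dist_onePointGH_le_iff.1 hd.le x y]
  set δ := a * (s - a) / (8 * s) with hδ
  have δ_eq : 8 * s * δ = a * (s - a) := by rw [hδ]; field_simp
  have δ_pos : 0 < δ := div_pos (mul_pos ha (sub_pos.2 has)) (by positivity)
  have δ_lt : 8 * δ < a := by nlinarith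
  have has' : a / s < 1 := (div_lt_one hs).2 has
  -- `U` shrinks the distances of `Z` by the factor `a / s`, `V` increases them by `s - a`.
  obtain ⟨U, u, hu, -, hU⟩ := exists_net_with_transformed_dist Z (fun r => a / s * r) (by simp)
    (fun r hr => by positivity)
    (fun b c d _ _ _ h => by
      rw [← mul_add]
      gcongr)
    (ε := (s - a) / 2) δ_pos
    (fun x y => by
      have h₁ : a / s * dist x y ≤ dist x y :=
        mul_le_of_le_one_left dist_nonneg has'.le
      have h₂ : (1 - a / s) * dist x y ≤ (1 - a / s) * s :=
        mul_le_mul_of_nonneg_left (hle x y) (by linarith)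
      have h₃ : (1 - a / s) * s = s - a := by field_simp
      rw [abs_of_nonneg (by linarith)]
      linarith)
  obtain ⟨V, v, hv, hnet, hV⟩ := exists_net_with_transformed_dist Z
    (fun r => if r ≤ 0 then 0 else min (r + (s - a)) s) (by simp)
    (fun r hr => by
      simp only [if_neg hr.not_ge]
      exact lt_min (by linarith) hs)
    (fun b c d hb hc hd h => by
      simp only [min_def]
      split_ifs <;> linarith)
    (ε := (s - a) / 2) δ_pos
    (fun x y => by
      have h₁ := hle x y
      have h₂ := dist_nonneg (x := x) (y := y)
      rw [abs_le]
      simp only [min_def]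
      split_ifs <;> constructor <;> linarith)
  have U_mem : U ∈ closedBall onePointGH (s / 2) :=
    mem_closedBall'.2 <| dist_onePointGH_le_iff.2 fun x y => by
      rw [hu]
      linarith [hle (u x) (u y), mul_le_of_le_one_left (dist_nonneg (x := u x) (y := u y)) has'.le]
  have V_mem : V ∈ closedBall onePointGH (s / 2) :=
    mem_closedBall'.2 <| dist_onePointGH_le_iff.2 fun x y => by
      rw [hv]
      split_ifs
      · linarith
      · linarith [min_le_right (dist (v x) (v y) + (s - a)) s]
  obtain ⟨R, -, hRr, hR⟩ := dist_le_iff_exists_correspondence.1 (hZ _ U U_mem V V_mem hU hV)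
  choose w hw using fun i => hnet (z i)
  choose y hy using fun i => hRr (w i)
  obtain ⟨i, j, hij, hmax'⟩ := hmax (u ∘ y)
  have h₁ := (abs_le.1 (hR _ _ _ _ (hy i) (hy j))).1
  have h₂ := dist_triangle4_right (z i) (z j) (v (w i)) (v (w j))
  have h₃ : a - 2 * δ ≤ dist (v (w i)) (v (w j)) := by linarith [hz i j hij, hw i, hw j]
  have h₄ : s - 2 * δ ≤ min (dist (v (w i)) (v (w j)) + (s - a)) s :=
    le_min (by linarith) (by linarith)
  have h₅ : a / s * dist (u (y i)) (u (y j)) ≤ a / s * a :=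
    mul_le_mul_of_nonneg_left hmax' (by positivity)
  rw [hu, hv, if_neg (by linarith)] at h₁
  have h₆ : a - 4 * δ ≤ a / s * a := by linarith
  rw [div_mul_eq_mul_div, le_div_iff₀ hs] at h₆
  nlinarith [mul_pos ha (sub_pos.2 has)]

theorem IsCentred.exists_eq_simplexGH {Z : GHSpace} {s : ℝ} (hs : 0 < s)
    (hZ : IsCentred (closedBall onePointGH (s / 2)) Z) (hd : dist onePointGH Z = s / 2) :
    ∃ (n : ℕ) (hn : 0 < n), Z = simplexGH n hn s hs := by
  classical
  have hex := exists_tuple_not_separated (X := Z.Rep) hs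
  obtain ⟨n, hn⟩ : ∃ n, Nat.find hex = n + 2 := by
    have h₂ : 2 ≤ Nat.find hex := by
      refine (Nat.le_find_iff hex 2).2 fun m hm => not_not.2 ?_
      obtain ⟨x⟩ : Nonempty Z.Rep := inferInstance
      exact ⟨fun _ => x, fun i j hij => absurd (Fin.ext (by omega)) hij⟩
    exact ⟨_, (Nat.sub_add_cancel h₂).symm⟩
  have hnot := Nat.find_spec hex
  rw [hn] at hnot
  obtain ⟨w, hw⟩ := not_not.1 (Nat.find_min hex (m := n + 1) (by omega))
  have w_inj : Function.Injective w := fun i j hij => by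
    by_contra hne
    have := hw i j hne
    rw [hij, dist_self] at this
    linarith
  by_cases w_surj : Function.Surjective w
  · have w_bij : Function.Bijective w := ⟨w_inj, w_surj⟩
    refine ⟨n + 1, n.succ_pos, eq_simplexGH_of_equiv _ _ (Equiv.ofBijective w w_bij)
      fun i j hij => le_antisymm ?_ (hw i j hij)⟩
    rw [Equiv.ofBijective_apply, Equiv.ofBijective_apply]
    linarith [dist_onePointGH_le_iff.1 hd.le (w i) (w j)]
  · obtain ⟨y, hy⟩ := not_forall.1 w_surj
    have cons_inj : Function.Injective (Fin.cons y w : Fin (n + 2) → Z.Rep) :=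
      Fin.cons_injective_iff.2 ⟨hy, w_inj⟩
    obtain ⟨z, a, hz, hmax⟩ := exists_max_separation (X := Z.Rep) (N := n + 2) (by omega)
    refine (hZ.not_max_separation hd ?_ ?_ z hz hmax).elim
    · obtain ⟨i, j, hij, h⟩ := hmax (Fin.cons y w)
      exact (dist_pos.2 (cons_inj.ne hij)).trans_le h
    · by_contra! h
      exact hnot ⟨z, fun i j hij => h.trans (hz i j hij)⟩

theorem map_onePointGH (f : GHSpace ≃ᵢ GHSpace) : f onePointGH = onePointGH :=
  (isCentred_onePointGH.map f fun _ _ => mem_univ _).eq_onePointGH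

theorem exists_map_simplexGH_eq (f : GHSpace ≃ᵢ GHSpace) {n : ℕ} (hn : 2 ≤ n) {hn' : 0 < n}
    {s : ℝ} (hs : 0 < s) :
    ∃ (m : ℕ) (hm : 0 < m), f (simplexGH n hn' s hs) = simplexGH m hm s hs := by
  refine IsCentred.exists_eq_simplexGH hs (isCentred_simplexGH.map f fun U hU => ?_) ?_
  · rwa [mem_closedBall, ← f.dist_eq, f.apply_symm_apply, map_onePointGH]
  · conv_lhs => rw [← map_onePointGH f]
    rw [f.dist_eq, dist_onePointGH_simplexGH hn]

/-- If a surjective isometry of the Gromov–Hausdorff space takes `tΔ_p` to `tΔ_q` for some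
`t > 0`, then it takes `sΔ_p` to `sΔ_q` for every `s > 0`. -/
theorem ghspace_isometry_simplex_scale
    (f : GromovHausdorff.GHSpace ≃ᵢ GromovHausdorff.GHSpace)
    (p q : ℕ) (hp : 2 ≤ p) (hq : 2 ≤ q) (t : ℝ) (ht : 0 < t)
    (hf : f (simplexGH p (by omega) t ht) = simplexGH q (by omega) t ht) :
    ∀ (s : ℝ) (hs : 0 < s),
      f (simplexGH p (by omega) s hs) = simplexGH q (by omega) s hs := by
  have hex : ∀ s : ℝ, ∃ m : ℕ, ∃ hm : 0 < m, ∀ hs : 0 < s,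
      f (simplexGH p (by omega) s hs) = simplexGH m hm s hs := fun s => by
    by_cases hs : 0 < s
    · obtain ⟨m, hm, h⟩ := exists_map_simplexGH_eq f hp (hn' := by omega) hs
      exact ⟨m, hm, fun _ => h⟩
    · exact ⟨1, one_pos, fun h => absurd h hs⟩
  choose m hm hfm using hex
  have hdist : ∀ s u : ℝ, ∀ hs : 0 < s, ∀ hu : 0 < u,
      dist (simplexGH (m s) (hm s) s hs) (simplexGH (m u) (hm u) u hu) ≤ |s - u| / 2 := by
    intro s u hs hu
    rw [← hfm, ← hfm, f.dist_eq]
    exact dist_simplexGH_simplexGH_le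
  intro s hs
  have hmt : m t = q := by
    have h : dist (simplexGH (m t) (hm t) t ht) (simplexGH q (by omega) t ht) < t / 2 := by
      rw [← hfm, hf, dist_self]
      exact half_pos ht
    exact card_eq_of_dist_simplexGH_lt h h
  have hms : m s = m t := by
    refine (isPreconnected_Ioi (a := (0 : ℝ))).induction₂' (fun x y => m x = m y)
      (fun x hx => ?_) (fun _ _ _ _ _ _ => Eq.trans) hs ht
    filter_upwards [self_mem_nhdsWithin,
      mem_nhdsWithin_of_mem_nhds (Metric.ball_mem_nhds x (half_pos hx))] with y hy hxy
    have h₁ := hdist x y hx hy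
    rw [mem_ball', Real.dist_eq] at hxy
    have h₂ := (abs_lt.1 hxy).2
    have h₃ : 0 < x := hx
    have h₄ : m x = m y :=
      card_eq_of_dist_simplexGH_lt (h₁.trans_lt (by linarith)) (h₁.trans_lt (by linarith))
    exact ⟨h₄, h₄.symm⟩
  rw [hfm]
  congr 1
  exact hms.trans hmt
end

section
/- For all integers p, q ≥ 2 and all reals t, s > 0: 2·d_GH(tΔ_p, sΔ_q) = |t − s| if p = q; 2·d_GH(tΔ_p, sΔ_q) = max{t, s − t} if p > q; and 2·d_GH(tΔ_p, sΔ_q) = max{s, t − s} if p < q. In particular, if p ≠ q then 2·d_GH(tΔ_p, sΔ_q) ≥ min{t, s}. -/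
open GromovHausdorff Metric

section Correspondence

variable {X Y : Type*} [MetricSpace X] [CompactSpace X] [Nonempty X]
  [MetricSpace Y] [CompactSpace Y] [Nonempty Y]

/-- A surjection whose distortion is at most `ε` bounds twice the Gromov–Hausdorff distance. -/
theorem two_mul_ghDist_le_of_surjective {f : X → Y} (hf : Function.Surjective f) {ε : ℝ}
    (h : ∀ x x', |dist x x' - dist (f x) (f x')| ≤ ε) : 2 * ghDist X Y ≤ ε := by
  have := ghDist_le_of_approx_subsets (s := (Set.univ : Set X)) (fun x => f x)
    (ε₁ := 0) (ε₂ := ε) (ε₃ := 0) (fun x => ⟨x, Set.mem_univ x, by simp⟩)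
    (fun y => by
      obtain ⟨x, rfl⟩ := hf y
      exact ⟨⟨x, Set.mem_univ x⟩, by simp⟩)
    (fun x x' => h x x')
  linarith

/-- If the Gromov–Hausdorff distance is less than `r`, then there is a correspondence of
distortion less than `2 * r`. -/
theorem exists_correspondence_of_ghDist_lt {r : ℝ} (hr : ghDist X Y < r) :
    ∃ R : X → Y → Prop, (∀ x, ∃ y, R x y) ∧ (∀ y, ∃ x, R x y) ∧
      ∀ x x' y y', R x y → R x' y' → |dist x x' - dist y y'| < 2 * r := by
  obtain ⟨Φ, Ψ, hΦ, hΨ, heq⟩ := ghDist_eq_hausdorffDist X Y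
  rw [heq] at hr
  have hfin : hausdorffEDist (Set.range Φ) (Set.range Ψ) ≠ ⊤ :=
    hausdorffEDist_ne_top_of_nonempty_of_bounded (Set.range_nonempty _) (Set.range_nonempty _)
      (isCompact_range hΦ.continuous).isBounded (isCompact_range hΨ.continuous).isBounded
  refine ⟨fun x y => dist (Φ x) (Ψ y) < r, fun x => ?_, fun y => ?_, ?_⟩
  · obtain ⟨_, ⟨y, rfl⟩, hy⟩ :=
      exists_dist_lt_of_hausdorffDist_lt (Set.mem_range_self x) hr hfin
    exact ⟨y, hy⟩
  · obtain ⟨_, ⟨x, rfl⟩, hx⟩ :=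
      exists_dist_lt_of_hausdorffDist_lt' (Set.mem_range_self y) hr hfin
    exact ⟨x, hx⟩
  · intro x x' y y' h h'
    have h₁ := dist_triangle4 (Φ x) (Ψ y) (Ψ y') (Φ x')
    have h₂ := dist_triangle4 (Ψ y) (Φ x) (Φ x') (Ψ y')
    rw [dist_comm (Ψ y') (Φ x')] at h₁
    rw [dist_comm (Ψ y) (Φ x)] at h₂
    rw [hΦ.dist_eq, hΨ.dist_eq] at h₁ h₂
    rw [abs_lt]
    constructor <;> linarith

end Correspondence

theorem two_mul_dist_simplexGH_le {p q : ℕ} (hp : 0 < p) (hq : 0 < q) {t s : ℝ} (ht : 0 < t)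
    (hs : 0 < s) {f : Fin p → Fin q} (hf : Function.Surjective f) {ε : ℝ}
    (h : ∀ i j, |(if i = j then 0 else t) - (if f i = f j then 0 else s)| ≤ ε) :
    2 * dist (simplexGH p hp t ht) (simplexGH q hq s hs) ≤ ε :=
  @two_mul_ghDist_le_of_surjective (Fin p) (Fin q) (simplexMetric p t ht)
    (@Finite.compactSpace _ (_) _) (Fin.pos_iff_nonempty.1 hp) (simplexMetric q s hs)
    (@Finite.compactSpace _ (_) _) (Fin.pos_iff_nonempty.1 hq) f hf ε h

theorem exists_correspondence_of_dist_simplexGH_lt {p q : ℕ} (hp : 0 < p) (hq : 0 < q) {t s : ℝ}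
    (ht : 0 < t) (hs : 0 < s) {r : ℝ}
    (hr : dist (simplexGH p hp t ht) (simplexGH q hq s hs) < r) :
    ∃ R : Fin p → Fin q → Prop, (∀ i, ∃ k, R i k) ∧ (∀ k, ∃ i, R i k) ∧
      ∀ i j k l, R i k → R j l →
        |(if i = j then 0 else t) - (if k = l then 0 else s)| < 2 * r :=
  @exists_correspondence_of_ghDist_lt (Fin p) (Fin q) (simplexMetric p t ht)
    (@Finite.compactSpace _ (_) _) (Fin.pos_iff_nonempty.1 hp) (simplexMetric q s hs)
    (@Finite.compactSpace _ (_) _) (Fin.pos_iff_nonempty.1 hq) r hr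

theorem sub_le_two_mul_dist_simplexGH {p q : ℕ} (hp : 0 < p) (hq : 0 < q) (hq₁ : 1 < q) {t s : ℝ}
    (ht : 0 < t) (hs : 0 < s) :
    s - t ≤ 2 * dist (simplexGH p hp t ht) (simplexGH q hq s hs) := by
  suffices (s - t) / 2 ≤ dist (simplexGH p hp t ht) (simplexGH q hq s hs) by linarith
  refine le_of_forall_gt fun r hr => ?_
  obtain ⟨R, -, hR, hdist⟩ := exists_correspondence_of_dist_simplexGH_lt _ _ ht hs hr
  obtain ⟨i, hi⟩ := hR ⟨0, hq⟩
  obtain ⟨j, hj⟩ := hR ⟨1, hq₁⟩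
  have h := (abs_lt.1 (hdist i j _ _ hi hj)).1
  rw [if_neg (c := (⟨0, _⟩ : Fin q) = ⟨1, _⟩) (by simp)] at h
  split_ifs at h <;> linarith

theorem le_two_mul_dist_simplexGH_of_lt {p q : ℕ} (hp : 0 < p) (hq : 0 < q) (hqp : q < p) {t s : ℝ}
    (ht : 0 < t) (hs : 0 < s) :
    t ≤ 2 * dist (simplexGH p hp t ht) (simplexGH q hq s hs) := by
  suffices t / 2 ≤ dist (simplexGH p hp t ht) (simplexGH q hq s hs) by linarith
  refine le_of_forall_gt fun r hr => ?_
  obtain ⟨R, hR, -, hdist⟩ := exists_correspondence_of_dist_simplexGH_lt _ _ ht hs hr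
  choose f hf using hR
  obtain ⟨i, j, hij, hfij⟩ := Fintype.exists_ne_map_eq_of_card_lt f (by simpa using hqp)
  have h := (abs_lt.1 (hdist i j _ _ (hf i) (hf j))).2
  rw [if_neg hij, if_pos hfij] at h
  linarith

theorem two_mul_dist_simplexGH_self {p : ℕ} (hp : 0 < p) (hp₁ : 1 < p) {t s : ℝ} (ht : 0 < t)
    (hs : 0 < s) :
    2 * dist (simplexGH p hp t ht) (simplexGH p hp s hs) = |t - s| := by
  refine le_antisymm (two_mul_dist_simplexGH_le _ _ ht hs Function.surjective_id fun i j => ?_)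
    (abs_le'.2 ⟨?_, ?_⟩)
  · by_cases hij : i = j <;> simp [hij]
  · rw [dist_comm]
    exact sub_le_two_mul_dist_simplexGH _ _ hp₁ hs ht
  · rw [neg_sub]
    exact sub_le_two_mul_dist_simplexGH _ _ hp₁ ht hs

theorem two_mul_dist_simplexGH_of_lt {p q : ℕ} (hp : 0 < p) (hq : 0 < q) (hq₁ : 1 < q)
    (hqp : q < p) {t s : ℝ} (ht : 0 < t) (hs : 0 < s) :
    2 * dist (simplexGH p hp t ht) (simplexGH q hq s hs) = max t (s - t) := by
  have : Nonempty (Fin q) := ⟨⟨0, hq⟩⟩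
  refine le_antisymm (two_mul_dist_simplexGH_le _ _ ht hs
    (Function.invFun_surjective (Fin.castLE_injective hqp.le)) fun i j => ?_)
    (max_le (le_two_mul_dist_simplexGH_of_lt _ _ hqp ht hs)
      (sub_le_two_mul_dist_simplexGH _ _ hq₁ ht hs))
  have h₁ := le_max_left t (s - t)
  have h₂ := le_max_right t (s - t)
  rw [abs_le]
  split_ifs with hij hf
  · constructor <;> linarith
  · exact absurd (congrArg _ hij) hf
  · constructor <;> linarith
  · constructor <;> linarith

/-- The Gromov–Hausdorff distance between two simplexes: for integers `p, q ≥ 2` and reals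
`t, s > 0`, `2 d_GH(tΔ_p, sΔ_q)` equals `|t - s|` if `p = q`, `max {t, s - t}` if `p > q`,
and `max {s, t - s}` if `p < q`; in particular it is at least `min {t, s}` when `p ≠ q`. -/
theorem ghDist_simplex_simplex (p q : ℕ) (hp : 2 ≤ p) (hq : 2 ≤ q)
    (t s : ℝ) (ht : 0 < t) (hs : 0 < s) :
    (p = q → 2 * dist (simplexGH p (by omega) t ht) (simplexGH q (by omega) s hs) = |t - s|) ∧
    (p > q → 2 * dist (simplexGH p (by omega) t ht) (simplexGH q (by omega) s hs) = max t (s - t)) ∧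
    (p < q → 2 * dist (simplexGH p (by omega) t ht) (simplexGH q (by omega) s hs) = max s (t - s)) ∧
    (p ≠ q → min t s ≤ 2 * dist (simplexGH p (by omega) t ht) (simplexGH q (by omega) s hs)) := by
  have hlt : p > q → 2 * dist (simplexGH p (by omega) t ht) (simplexGH q (by omega) s hs) =
      max t (s - t) := fun h => two_mul_dist_simplexGH_of_lt _ _ hq h ht hs
  have hgt : p < q → 2 * dist (simplexGH p (by omega) t ht) (simplexGH q (by omega) s hs) =
      max s (t - s) := fun h => by
    rw [dist_comm]
    exact two_mul_dist_simplexGH_of_lt _ _ hp h hs ht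
  refine ⟨?_, hlt, hgt, fun hne => ?_⟩
  · rintro rfl
    exact two_mul_dist_simplexGH_self _ hp ht hs
  · rcases hne.lt_or_gt with h | h
    · rw [hgt h]
      exact (min_le_right t s).trans (le_max_left _ _)
    · rw [hlt h]
      exact (min_le_left t s).trans (le_max_left _ _)
end

section
/- Let X be a nonempty compact metric space containing a subspace isometric to tΔ_n for some integer n ≥ 2 and real t > 0, and let M be a nonempty finite metric space with #M ≤ n − 1. Then 2·d_GH(X, M) ≥ t. Moreover, if in addition diam X = t and diam M ≤ t, then 2·d_GH(X, M) = t. -/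
open GromovHausdorff Metric in
/-- Two spaces of diameter at most `2 * ε` are at Gromov-Hausdorff distance at most `ε`. -/
theorem ghDist_le_of_diam_le {X Y : Type*} [MetricSpace X] [CompactSpace X] [Nonempty X]
    [MetricSpace Y] [CompactSpace Y] [Nonempty Y] {ε : ℝ} (hε : 0 < ε)
    (hX : diam (Set.univ : Set X) ≤ 2 * ε) (hY : diam (Set.univ : Set Y) ≤ 2 * ε) :
    ghDist X Y ≤ ε := by
  have hdX (x x' : X) : dist x x' ≤ 2 * ε :=
    (dist_le_diam_of_mem isCompact_univ.isBounded trivial trivial).trans hX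
  have hdY (y y' : Y) : dist y y' ≤ 2 * ε :=
    (dist_le_diam_of_mem isCompact_univ.isBounded trivial trivial).trans hY
  let _ : MetricSpace (X ⊕ Y) :=
    glueMetricApprox (Prod.fst : X × Y → X) (Prod.snd : X × Y → Y) ε hε fun p q =>
      abs_sub_le_iff.2 ⟨by linarith [hdX p.1 q.1, dist_nonneg (x := p.2) (y := q.2)],
        by linarith [hdY p.2 q.2, dist_nonneg (x := p.1) (y := q.1)]⟩
  have hinl : Isometry (Sum.inl : X → X ⊕ Y) := Isometry.of_dist_eq fun _ _ => rfl
  have hinr : Isometry (Sum.inr : Y → X ⊕ Y) := Isometry.of_dist_eq fun _ _ => rfl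
  have hd (x : X) (y : Y) : dist (Sum.inl x : X ⊕ Y) (Sum.inr y) = ε :=
    glueDist_glued_points (Prod.fst : X × Y → X) Prod.snd ε (x, y)
  refine (ghDist_le_hausdorffDist hinl hinr).trans (hausdorffDist_le_of_mem_dist hε.le ?_ ?_)
  · rintro _ ⟨x, rfl⟩
    exact ⟨_, ⟨Classical.arbitrary Y, rfl⟩, (hd _ _).le⟩
  · rintro _ ⟨y, rfl⟩
    exact ⟨_, ⟨Classical.arbitrary X, rfl⟩, (dist_comm _ _).trans_le (hd _ _).le⟩

open GromovHausdorff Metric in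
/-- If `X` contains more points with pairwise distances at least `t` than `M` has points, then
`t ≤ 2 * ghDist X M`. -/
theorem le_two_mul_ghDist_of_card_lt {X M ι : Type*} [MetricSpace X] [CompactSpace X] [Nonempty X]
    [MetricSpace M] [Finite M] [Nonempty M] {t : ℝ} (c : ι → X)
    (hc : Pairwise fun i j => t ≤ dist (c i) (c j)) (hM : Nat.card M < Nat.card ι) :
    t ≤ 2 * ghDist X M := by
  by_contra! hlt
  obtain ⟨Φ, Ψ, hΦ, hΨ, h⟩ := ghDist_eq_hausdorffDist X M
  have hfin : hausdorffEDist (Set.range Φ) (Set.range Ψ) ≠ ⊤ :=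
    hausdorffEDist_ne_top_of_nonempty_of_bounded (Set.range_nonempty _) (Set.range_nonempty _)
      (isCompact_range hΦ.continuous).isBounded (isCompact_range hΨ.continuous).isBounded
  have hclose (i : ι) : ∃ m, dist (Φ (c i)) (Ψ m) < t / 2 := by
    obtain ⟨_, ⟨m, rfl⟩, hm⟩ := exists_dist_lt_of_hausdorffDist_lt
      (Set.mem_range_self (c i)) (show hausdorffDist (Set.range Φ) (Set.range Ψ) < t / 2 by
        linarith) hfin
    exact ⟨m, hm⟩
  choose f hf using hclose
  have hninj : ¬ Function.Injective f := fun hinj =>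
    hM.not_ge (Nat.card_le_card_of_injective f hinj)
  obtain ⟨i, j, hij, hne⟩ := Function.not_injective_iff.1 hninj
  have hj := hf j
  rw [← hij] at hj
  linarith [hc hne, hΦ.dist_eq (c i) (c j), hf i,
    dist_triangle_right (Φ (c i)) (Φ (c j)) (Ψ (f i))]

/-- If a nonempty compact metric space `X` contains `n` points with all pairwise distances
equal to `t` (i.e. a subspace isometric to `tΔ_n`), and `M` is a nonempty finite metric
space with at most `n - 1` points, then `2 d_GH(X, M) ≥ t`; moreover, if `diam X = t` and
`diam M ≤ t`, then `2 d_GH(X, M) = t`. -/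
theorem ghDist_ge_of_simplex_subspace (n : ℕ) (hn : 2 ≤ n) (t : ℝ) (ht : 0 < t)
    (X : Type*) [MetricSpace X] [CompactSpace X] [Nonempty X]
    (M : Type*) [MetricSpace M] [Finite M] [Nonempty M]
    (c : Fin n → X) (hc : ∀ i j : Fin n, i ≠ j → dist (c i) (c j) = t)
    (hM : Nat.card M ≤ n - 1) :
    t ≤ 2 * GromovHausdorff.ghDist X M ∧
    (Metric.diam (Set.univ : Set X) = t → Metric.diam (Set.univ : Set M) ≤ t →
      2 * GromovHausdorff.ghDist X M = t) := by
  have hle : t ≤ 2 * GromovHausdorff.ghDist X M :=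
    le_two_mul_ghDist_of_card_lt c (fun i j hij => (hc i j hij).ge) (by
      rw [Nat.card_fin]; omega)
  refine ⟨hle, fun hX hdM => le_antisymm ?_ hle⟩
  have := ghDist_le_of_diam_le (X := X) (Y := M) (half_pos ht) (by linarith) (by linarith)
  linarith
end

section
/- Let X and Y be nonempty sets and let R ⊆ X × Y be an irreducible correspondence between X and Y. Then there exist an index set I and partitions {X_i}_{i∈I} of X and {Y_i}_{i∈I} of Y into nonempty subsets such that R = ⋃_{i∈I} X_i × Y_i. Concretely, the family of sets R(x) = {y : (x,y) ∈ R}, x ∈ X, is a partition of Y, the family of sets R⁻¹(y) = {x : (x,y) ∈ R}, y ∈ Y, is a partition of X, and R is the union of the products R⁻¹(y) × R(x) over matching parts. -/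
universe u v

/-- A relation `R ⊆ X × Y` is a correspondence if both canonical projections restricted
to `R` are surjective. -/
def IsCorrespondence {X Y : Type*} (R : Set (X × Y)) : Prop :=
  (∀ x : X, ∃ y : Y, (x, y) ∈ R) ∧ ∀ y : Y, ∃ x : X, (x, y) ∈ R

/-- In an irreducible correspondence, every edge has an endpoint of degree one. -/
theorem IsCorrespondence.eq_or_eq_of_irreducible {X Y : Type*} {R : Set (X × Y)}
    (hR : IsCorrespondence R)
    (hirr : ∀ R' : Set (X × Y), R' ⊆ R → IsCorrespondence R' → R' = R)
    {x : X} {y : Y} (hxy : (x, y) ∈ R) :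
    (∀ y', (x, y') ∈ R → y' = y) ∨ ∀ x', (x', y) ∈ R → x' = x := by
  by_contra! h
  obtain ⟨⟨y₁, hy₁, hne_y⟩, x₁, hx₁, hne_x⟩ := h
  have hdiff : R \ {(x, y)} = R := by
    refine hirr _ Set.sdiff_subset ⟨fun a => ?_, fun b => ?_⟩
    · by_cases ha : a = x
      · exact ⟨y₁, by simp [ha, hy₁, hne_y]⟩
      · obtain ⟨b, hb⟩ := hR.1 a
        exact ⟨b, by simp [ha, hb]⟩
    · by_cases hb : b = y
      · exact ⟨x₁, by simp [hb, hx₁, hne_x]⟩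
      · obtain ⟨a, ha⟩ := hR.2 b
        exact ⟨a, by simp [ha, hb]⟩
  exact (hdiff.symm ▸ hxy : (x, y) ∈ R \ {(x, y)}).2 rfl

/-- An irreducible correspondence is difunctional. -/
theorem IsCorrespondence.mem_of_irreducible {X Y : Type*} {R : Set (X × Y)}
    (hR : IsCorrespondence R)
    (hirr : ∀ R' : Set (X × Y), R' ⊆ R → IsCorrespondence R' → R' = R)
    {x x' : X} {y y' : Y} (h₁ : (x, y) ∈ R) (h₂ : (x', y) ∈ R) (h₃ : (x', y') ∈ R) :
    (x, y') ∈ R := by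
  rcases hR.eq_or_eq_of_irreducible hirr h₂ with h | h
  · rwa [h y' h₃]
  · rwa [h x h₁]

/-- **Structure of irreducible correspondences.** If `R` is an irreducible correspondence
between nonempty sets `X` and `Y`, then there are partitions `{X_i}` of `X` and `{Y_i}` of
`Y` into nonempty parts with `R = ⋃ᵢ X_i × Y_i`; concretely, the images `R(x)` form a
partition of `Y`, the preimages `R⁻¹(y)` form a partition of `X`, and `R` is the union of
the products `R⁻¹(y) × R(x)` over pairs `(x, y) ∈ R`. -/
theorem irreducible_correspondence_partition {X : Type u} {Y : Type v}
    [Nonempty X] [Nonempty Y]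
    (R : Set (X × Y)) (hR : IsCorrespondence R)
    (hirr : ∀ R' : Set (X × Y), R' ⊆ R → IsCorrespondence R' → R' = R) :
    (∃ (I : Type (max u v)) (XP : I → Set X) (YP : I → Set Y),
      (∀ i, (XP i).Nonempty) ∧ (∀ i, (YP i).Nonempty) ∧
      Pairwise (Function.onFun Disjoint XP) ∧ Pairwise (Function.onFun Disjoint YP) ∧
      (⋃ i, XP i) = Set.univ ∧ (⋃ i, YP i) = Set.univ ∧
      R = ⋃ i, XP i ×ˢ YP i) ∧
    (∀ x x' : X, {y | (x, y) ∈ R} = {y | (x', y) ∈ R} ∨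
      Disjoint {y | (x, y) ∈ R} {y | (x', y) ∈ R}) ∧
    (∀ y y' : Y, {x | (x, y) ∈ R} = {x | (x, y') ∈ R} ∨
      Disjoint {x | (x, y) ∈ R} {x | (x, y') ∈ R}) ∧
    R = ⋃ p ∈ R, {x | (x, p.2) ∈ R} ×ˢ {y | (p.1, y) ∈ R} := by
  have hdif : ∀ {x x' : X} {y y' : Y}, (x, y) ∈ R → (x', y) ∈ R → (x', y') ∈ R →
      (x, y') ∈ R := hR.mem_of_irreducible hirr
  have himage : ∀ {x x' : X} {y : Y}, (x, y) ∈ R → (x', y) ∈ R →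
      {y | (x, y) ∈ R} = {y | (x', y) ∈ R} := fun h h' =>
    Set.ext fun _ => ⟨hdif h' h, hdif h h'⟩
  have hpreimage : ∀ {x : X} {y y' : Y}, (x, y) ∈ R → (x, y') ∈ R →
      {x | (x, y) ∈ R} = {x | (x, y') ∈ R} := fun h h' =>
    Set.ext fun _ => ⟨fun k => hdif k h h', fun k => hdif k h' h⟩
  have hunion : R = ⋃ p ∈ R, {x | (x, p.2) ∈ R} ×ˢ {y | (p.1, y) ∈ R} := by
    ext ⟨x, y⟩
    simp only [Set.mem_iUnion, Set.mem_prod, Set.mem_ofPred_eq]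
    exact ⟨fun h => ⟨(x, y), h, h, h⟩, fun ⟨_, hp, hx, hy⟩ => hdif hx hp hy⟩
  refine ⟨?_, fun x x' => ?_, fun y y' => ?_, hunion⟩
  · let part : R → Set X × Set Y :=
      fun p => ({x | (x, p.1.2) ∈ R}, {y | (p.1.1, y) ∈ R})
    refine ⟨Set.range part, fun i => i.1.1, fun i => i.1.2, ?_, ?_, ?_, ?_, ?_, ?_, ?_⟩
    · rintro ⟨_, p, rfl⟩
      exact ⟨p.1.1, p.2⟩
    · rintro ⟨_, p, rfl⟩
      exact ⟨p.1.2, p.2⟩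
    · rintro ⟨_, p, rfl⟩ ⟨_, q, rfl⟩ hne
      refine Set.disjoint_left.2 fun x (hp : (x, p.1.2) ∈ R) (hq : (x, q.1.2) ∈ R) => hne ?_
      exact Subtype.ext (Prod.ext (hpreimage hp hq)
        ((himage p.2 hp).trans (himage hq q.2)))
    · rintro ⟨_, p, rfl⟩ ⟨_, q, rfl⟩ hne
      refine Set.disjoint_left.2 fun y (hp : (p.1.1, y) ∈ R) (hq : (q.1.1, y) ∈ R) => hne ?_
      exact Subtype.ext (Prod.ext ((hpreimage p.2 hp).trans (hpreimage hq q.2))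
        (himage hp hq))
    · refine Set.eq_univ_of_forall fun x => ?_
      obtain ⟨y, hxy⟩ := hR.1 x
      exact Set.mem_iUnion.2 ⟨⟨_, ⟨(x, y), hxy⟩, rfl⟩, hxy⟩
    · refine Set.eq_univ_of_forall fun y => ?_
      obtain ⟨x, hxy⟩ := hR.2 y
      exact Set.mem_iUnion.2 ⟨⟨_, ⟨(x, y), hxy⟩, rfl⟩, hxy⟩
    · ext ⟨x, y⟩
      refine ⟨fun h => Set.mem_iUnion.2 ⟨⟨_, ⟨(x, y), h⟩, rfl⟩, h, h⟩, fun h => ?_⟩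
      obtain ⟨⟨_, p, rfl⟩, hx, hy⟩ := Set.mem_iUnion.1 h
      exact hdif hx p.2 hy
  · refine or_iff_not_imp_right.2 fun h => ?_
    obtain ⟨_, hy, hy'⟩ := Set.not_disjoint_iff.1 h
    exact himage hy hy'
  · refine or_iff_not_imp_right.2 fun h => ?_
    obtain ⟨_, hx, hx'⟩ := Set.not_disjoint_iff.1 h
    exact hpreimage hx hx'
end

section
/- Let f be a surjective isometry of the Gromov–Hausdorff space onto itself and let n be a positive integer. If X ∈ GHSpace is the class of a metric space with exactly n points, then f(X) is the class of a metric space with exactly n points, and diam f(X) = diam X. -/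
open GromovHausdorff

namespace GHIsometry

/-- `R` is a correspondence between `α` and `β` of distortion at most `c`. -/
def IsCorr {α β : Type*} [Dist α] [Dist β] (R : α → β → Prop) (c : ℝ) : Prop :=
  (∀ a, ∃ b, R a b) ∧ (∀ b, ∃ a, R a b) ∧
    ∀ a a' b b', R a b → R a' b' → |dist a a' - dist b b'| ≤ c

theorem two_mul_dist_le {p q : GHSpace} {R : p.Rep → q.Rep → Prop} {c : ℝ} (hR : IsCorr R c) :
    2 * dist p q ≤ c := by
  obtain ⟨h1, h2, h3⟩ := hR
  have hc : 0 ≤ c := by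
    obtain ⟨a⟩ : Nonempty p.Rep := inferInstance
    obtain ⟨b, hb⟩ := h1 a
    exact (abs_nonneg _).trans (h3 a a b b hb hb)
  suffices h : dist p q ≤ c / 2 by linarith
  refine le_of_forall_pos_le_add fun ε hε => ?_
  obtain ⟨a₀⟩ : Nonempty p.Rep := inferInstance
  have : Nonempty {z : p.Rep × q.Rep // R z.1 z.2} := by
    obtain ⟨b, hb⟩ := h1 a₀
    exact ⟨⟨(a₀, b), hb⟩⟩
  let Φ : {z : p.Rep × q.Rep // R z.1 z.2} → p.Rep := fun z => z.1.1
  let Ψ : {z : p.Rep × q.Rep // R z.1 z.2} → q.Rep := fun z => z.1.2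
  let := Metric.glueMetricApprox Φ Ψ (c / 2 + ε) (by positivity) (fun z w => by
    have := h3 _ _ _ _ z.2 w.2
    linarith)
  have hl : Isometry (Sum.inl : p.Rep → p.Rep ⊕ q.Rep) := Isometry.of_dist_eq fun _ _ => rfl
  have hr : Isometry (Sum.inr : q.Rep → p.Rep ⊕ q.Rep) := Isometry.of_dist_eq fun _ _ => rfl
  have hd : ∀ a b, R a b → dist (Sum.inl a : p.Rep ⊕ q.Rep) (Sum.inr b) ≤ c / 2 + ε := by
    intro a b hab
    exact (Metric.glueDist_glued_points Φ Ψ (c / 2 + ε) ⟨(a, b), hab⟩).le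
  rw [dist_ghDist]
  refine (ghDist_le_hausdorffDist hl hr).trans ?_
  refine Metric.hausdorffDist_le_of_mem_dist (by positivity) ?_ ?_
  · rintro _ ⟨a, rfl⟩
    obtain ⟨b, hb⟩ := h1 a
    exact ⟨_, ⟨b, rfl⟩, hd a b hb⟩
  · rintro _ ⟨b, rfl⟩
    obtain ⟨a, ha⟩ := h2 b
    exact ⟨_, ⟨a, rfl⟩, by rw [dist_comm]; exact hd a b ha⟩

theorem exists_isCorr (p q : GHSpace) : ∃ R : p.Rep → q.Rep → Prop, IsCorr R (2 * dist p q) := by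
  have hl := isometry_optimalGHInjl p.Rep q.Rep
  have hr := isometry_optimalGHInjr p.Rep q.Rep
  have hlc := isCompact_range hl.continuous
  have hrc := isCompact_range hr.continuous
  have hD : Metric.hausdorffDist (Set.range (optimalGHInjl p.Rep q.Rep))
      (Set.range (optimalGHInjr p.Rep q.Rep)) = dist p q := by
    rw [hausdorffDist_optimal, dist_ghDist]
  have hfin : Metric.hausdorffEDist (Set.range (optimalGHInjl p.Rep q.Rep))
      (Set.range (optimalGHInjr p.Rep q.Rep)) ≠ ⊤ :=
    Metric.hausdorffEDist_ne_top_of_nonempty_of_bounded (Set.range_nonempty _)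
      (Set.range_nonempty _) hlc.isBounded hrc.isBounded
  refine ⟨fun a b => dist (optimalGHInjl p.Rep q.Rep a) (optimalGHInjr p.Rep q.Rep b) ≤ dist p q,
    fun a => ?_, fun b => ?_, fun a a' b b' h h' => ?_⟩
  · obtain ⟨_, ⟨b, rfl⟩, hb⟩ := hrc.exists_infDist_eq_dist (Set.range_nonempty _)
      (optimalGHInjl p.Rep q.Rep a)
    refine ⟨b, ?_⟩
    beta_reduce
    rw [← hb, ← hD]
    exact Metric.infDist_le_hausdorffDist_of_mem ⟨a, rfl⟩ hfin
  · obtain ⟨_, ⟨a, rfl⟩, ha⟩ := hlc.exists_infDist_eq_dist (Set.range_nonempty _)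
      (optimalGHInjr p.Rep q.Rep b)
    refine ⟨a, ?_⟩
    beta_reduce
    rw [dist_comm, ← ha, ← hD, Metric.hausdorffDist_comm]
    rw [Metric.hausdorffEDist_comm] at hfin
    exact Metric.infDist_le_hausdorffDist_of_mem ⟨b, rfl⟩ hfin
  · rw [← hl.dist_eq a a', ← hr.dist_eq b b', ← Real.dist_eq]
    exact (dist_dist_dist_le _ _ _ _).trans (by linarith)

/-- A metric on `α` that is compact up to finitely many points is represented in `GHSpace`. -/
theorem exists_rep {α X : Type*} [MetricSpace X] [CompactSpace X] [Nonempty X] (d : α → α → ℝ)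
    (h_self : ∀ a, d a a = 0) (h_comm : ∀ a b, d a b = d b a)
    (h_tri : ∀ a b c, d a c ≤ d a b + d b c) (h_pos : ∀ a b, a ≠ b → 0 < d a b)
    (g : X → α) (hg : ∀ x y, d (g x) (g y) = dist x y) (hfin : (Set.range g)ᶜ.Finite) :
    ∃ (p : GHSpace) (e : p.Rep ≃ α), ∀ x y, dist x y = d (e x) (e y) := by
  let : MetricSpace α :=
    { dist := d
      dist_self := h_self
      dist_comm := h_comm
      dist_triangle := h_tri
      eq_of_dist_eq_zero := fun {a b} h => by
        by_contra hab
        exact (h_pos a b hab).ne' h }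
  have hgi : Isometry g := Isometry.of_dist_eq hg
  have : CompactSpace α := ⟨by
    rw [← Set.union_compl_self (Set.range g)]
    exact (isCompact_range hgi.continuous).union hfin.isCompact⟩
  have : Nonempty α := Nonempty.map g inferInstance
  obtain ⟨e⟩ := toGHSpace_eq_toGHSpace_iff_isometryEquiv.1 (GHSpace.toGHSpace_rep (toGHSpace α))
  exact ⟨toGHSpace α, e.toEquiv, fun x y => (e.dist_eq x y).symm⟩

theorem exists_rep_finite {α : Type*} [Finite α] [Nonempty α] (d : α → α → ℝ)
    (h_self : ∀ a, d a a = 0) (h_comm : ∀ a b, d a b = d b a)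
    (h_tri : ∀ a b c, d a c ≤ d a b + d b c) (h_pos : ∀ a b, a ≠ b → 0 < d a b) :
    ∃ (p : GHSpace) (e : p.Rep ≃ α), ∀ x y, dist x y = d (e x) (e y) :=
  exists_rep d h_self h_comm h_tri h_pos (fun _ : Unit => Classical.arbitrary α)
    (by simp [h_self]) (Set.toFinite _)

theorem exists_pos_le {ι : Type*} [Finite ι] (f : ι → ℝ) :
    ∃ g, 0 < g ∧ ∀ i, 0 < f i → g ≤ f i := by
  classical
  cases isEmpty_or_nonempty ι
  · exact ⟨1, one_pos, fun i => isEmptyElim i⟩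
  · obtain ⟨i, hi⟩ := Finite.exists_min fun i => if 0 < f i then f i else 1
    refine ⟨if 0 < f i then f i else 1, by split_ifs <;> simp_all, fun j hj => ?_⟩
    simpa [hj] using hi j

/-- A correspondence of distortion `c` with a space whose distinct points are more than `c` apart
is a map. -/
theorem exists_label {α β : Type*} [MetricSpace α] [MetricSpace β] {R : α → β → Prop} {c : ℝ}
    (hR : IsCorr R c) (hα : ∀ x y : α, dist x y ≤ c → x = y) :
    ∃ a : β → α, Function.Surjective a ∧ ∀ y y', |dist (a y) (a y') - dist y y'| ≤ c := by
  obtain ⟨h1, h2, h3⟩ := hR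
  choose a ha using h2
  refine ⟨a, fun x => ?_, fun y y' => h3 _ _ _ _ (ha y) (ha y')⟩
  obtain ⟨y, hy⟩ := h1 x
  refine ⟨y, hα _ _ ?_⟩
  have := h3 _ _ _ _ (ha y) hy
  rw [dist_self, sub_zero] at this
  exact (le_abs_self _).trans this

theorem isCorr_of_labels {α β γ : Type*} [MetricSpace β] [MetricSpace γ]
    {a : β → α} {b : γ → α} (ha : Function.Surjective a) (hb : Function.Surjective b) {c : ℝ}
    (h : ∀ y y' z z', a y = b z → a y' = b z' → |dist y y' - dist z z'| ≤ c) :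
    IsCorr (fun y z => a y = b z) c :=
  ⟨fun y => (hb (a y)).imp fun _ h => h.symm, fun z => ha (b z), h⟩

theorem onePoint_subsingleton : Subsingleton onePointGH.Rep := by
  let := simplexMetric 1 1 one_pos
  have : Nonempty (Fin 1) := ⟨0⟩
  obtain ⟨e⟩ := toGHSpace_eq_toGHSpace_iff_isometryEquiv.1
    (show toGHSpace onePointGH.Rep = toGHSpace (Fin 1) from GHSpace.toGHSpace_rep onePointGH)
  exact e.toEquiv.subsingleton

theorem dist_le_ghDiam (p : GHSpace) (x y : p.Rep) : dist x y ≤ ghDiam p :=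
  Metric.dist_le_diam_of_mem isCompact_univ.isBounded (Set.mem_univ x) (Set.mem_univ y)

theorem ghDiam_nonneg (p : GHSpace) : 0 ≤ ghDiam p := Metric.diam_nonneg

theorem ghDiam_le {p : GHSpace} {t : ℝ} (h : ∀ x y : p.Rep, dist x y ≤ t) : ghDiam p ≤ t := by
  obtain ⟨x⟩ : Nonempty p.Rep := inferInstance
  exact Metric.diam_le_of_forall_dist_le (by simpa using h x x) fun x _ y _ => h x y

theorem two_mul_dist_le_max (p q : GHSpace) : 2 * dist p q ≤ max (ghDiam p) (ghDiam q) := by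
  refine two_mul_dist_le (R := fun _ _ => True)
    ⟨fun _ => ⟨Classical.arbitrary _, trivial⟩, fun _ => ⟨Classical.arbitrary _, trivial⟩,
      fun a a' b b' _ _ => abs_sub_le_iff.2 ⟨?_, ?_⟩⟩
  · exact le_max_of_le_left (by linarith [dist_le_ghDiam p a a', @dist_nonneg _ _ b b'])
  · exact le_max_of_le_right (by linarith [dist_le_ghDiam q b b', @dist_nonneg _ _ a a'])

theorem ghDiam_onePoint : ghDiam onePointGH = 0 := by
  have := onePoint_subsingleton
  refine le_antisymm (ghDiam_le fun x y => ?_) (ghDiam_nonneg _)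
  rw [Subsingleton.elim x y, dist_self]

theorem ghDiam_eq (p : GHSpace) : ghDiam p = 2 * dist p onePointGH := by
  have := onePoint_subsingleton
  refine le_antisymm (ghDiam_le fun x y => ?_) ?_
  · obtain ⟨R, h1, -, h3⟩ := exists_isCorr p onePointGH
    obtain ⟨b, hb⟩ := h1 x
    obtain ⟨b', hb'⟩ := h1 y
    have := h3 _ _ _ _ hb hb'
    rw [Subsingleton.elim b b', dist_self, sub_zero] at this
    exact (le_abs_self _).trans this
  · have := two_mul_dist_le_max p onePointGH
    rwa [ghDiam_onePoint, max_eq_left (ghDiam_nonneg p)] at this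

theorem exists_separated (p W : GHSpace) [Finite W.Rep] {N : ℕ} (x : Fin N → p.Rep)
    (hx : Function.Injective x) (hN : Nat.card W.Rep < N) {r : ℝ} (hr : 0 < r) :
    ∃ Z : GHSpace, 2 * dist p Z < r ∧ r ≤ 2 * dist W Z ∧
      ∀ q, 2 * dist q Z ≤ max (2 * dist q p) r := by
  classical
  let π : p.Rep ⊕ Fin N → p.Rep := Sum.elim id x
  let w : p.Rep ⊕ Fin N → ℝ := Sum.elim (fun _ => 0) (fun _ => r / 2)
  have hw0 : ∀ a, 0 ≤ w a := by
    rintro (a | a)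
    · exact le_rfl
    · exact (half_pos hr).le
  have hwr : ∀ a, w a ≤ r / 2 := by
    rintro (a | a)
    · exact (half_pos hr).le
    · exact le_rfl
  let d : p.Rep ⊕ Fin N → p.Rep ⊕ Fin N → ℝ := fun a b =>
    if a = b then 0 else max (dist (π a) (π b)) (w a + w b)
  have hd_self : ∀ a, d a a = 0 := fun a => if_pos rfl
  have hd_ne : ∀ a b, a ≠ b → d a b = max (dist (π a) (π b)) (w a + w b) := fun a b h => if_neg h
  have hd_lower : ∀ a b, dist (π a) (π b) ≤ d a b := by
    intro a b
    rcases eq_or_ne a b with rfl | hab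
    · rw [hd_self, dist_self]
    · rw [hd_ne a b hab]
      exact le_max_left _ _
  obtain ⟨Z, e, he⟩ : ∃ (Z : GHSpace) (e : Z.Rep ≃ p.Rep ⊕ Fin N),
      ∀ x y, dist x y = d (e x) (e y) := by
    refine exists_rep d hd_self (fun a b => ?_) (fun a b c => ?_) (fun a b hab => ?_) Sum.inl
      (fun u v => ?_) ?_
    · rcases eq_or_ne a b with rfl | hab
      · rfl
      · rw [hd_ne a b hab, hd_ne b a hab.symm, dist_comm, add_comm]
    · rcases eq_or_ne a b with rfl | hab
      · rw [hd_self, zero_add]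
      rcases eq_or_ne b c with rfl | hbc
      · rw [hd_self, add_zero]
      rcases eq_or_ne a c with rfl | hac
      · rw [hd_self]
        exact add_nonneg (dist_nonneg.trans (hd_lower _ _)) (dist_nonneg.trans (hd_lower _ _))
      rw [hd_ne a c hac, hd_ne a b hab, hd_ne b c hbc]
      refine max_le ?_ ?_
      · exact (dist_triangle _ (π b) _).trans (add_le_add (le_max_left _ _) (le_max_left _ _))
      · have h1 := le_max_right (dist (π a) (π b)) (w a + w b)
        have h2 := le_max_right (dist (π b) (π c)) (w b + w c)
        linarith [hw0 b]
    · rw [hd_ne a b hab]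
      rcases a with a | a <;> rcases b with b | b
      · refine lt_max_of_lt_left (dist_pos.2 fun h => hab ?_)
        exact congrArg Sum.inl h
      · exact lt_max_of_lt_right (by simpa [w] using hr)
      · exact lt_max_of_lt_right (by simpa [w] using hr)
      · exact lt_max_of_lt_right (by simpa [w] using hr)
    · rcases eq_or_ne u v with rfl | huv
      · rw [hd_self, dist_self]
      · rw [hd_ne _ _ (Sum.inl_injective.ne huv)]
        simp [π, w]
    · rw [Set.compl_range_inl]
      exact Set.finite_range _
  have hsurj : ∀ u, ∃ z, π (e z) = u := fun u => ⟨e.symm (Sum.inl u), by simp [π]⟩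
  refine ⟨Z, ?_, ?_, fun q => ?_⟩
  · obtain ⟨g, hg, hgx⟩ := exists_pos_le fun i : Fin N × Fin N => dist (x i.1) (x i.2)
    refine (two_mul_dist_le (R := fun u z => u = π (e z)) (c := max (r / 2) (r - g))
      ⟨fun u => (hsurj u).imp fun _ h => h.symm, fun z => ⟨_, rfl⟩, ?_⟩).trans_lt
      (max_lt (by linarith) (by linarith))
    rintro _ _ z z' rfl rfl
    rw [he]
    generalize e z = a
    generalize e z' = b
    rw [abs_sub_comm, abs_of_nonneg (sub_nonneg.2 (hd_lower a b)), sub_le_iff_le_add]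
    have hc := le_max_left (r / 2) (r - g)
    have hc' := le_max_right (r / 2) (r - g)
    have hdn : 0 ≤ dist (π a) (π b) := dist_nonneg
    rcases eq_or_ne a b with rfl | hab
    · rw [hd_self]
      linarith
    · rw [hd_ne a b hab]
      refine max_le (by linarith) ?_
      rcases a with a | a <;> rcases b with b | b
      · simp only [w, Sum.elim_inl]
        linarith
      · simp only [w, Sum.elim_inl, Sum.elim_inr]
        linarith
      · simp only [w, Sum.elim_inl, Sum.elim_inr]
        linarith
      · have h := hgx (a, b) (dist_pos.2 (hx.ne fun h => hab (congrArg Sum.inr h)))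
        simp only [w, Sum.elim_inr, π] at h ⊢
        linarith
  · obtain ⟨R, -, h2, h3⟩ := exists_isCorr W Z
    choose s hs using fun i : Fin N => h2 (e.symm (Sum.inr i))
    obtain ⟨i, j, hij, hne⟩ : ∃ i j, s i = s j ∧ i ≠ j := by
      by_contra! hcon
      have := Nat.card_le_card_of_injective s fun i j h => hcon i j h
      rw [Nat.card_fin] at this
      exact hN.not_ge this
    have h := h3 _ _ _ _ (hs i) (hs j)
    rw [hij, dist_self, zero_sub, abs_neg, he, e.apply_symm_apply, e.apply_symm_apply,
      hd_ne _ _ (Sum.inr_injective.ne hne)] at h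
    refine le_trans ?_ ((le_abs_self _).trans h)
    refine le_trans (le_of_eq ?_) (le_max_right _ _)
    simp [w]
  · obtain ⟨R, h1, h2, h3⟩ := exists_isCorr q p
    refine two_mul_dist_le (R := fun v z => R v (π (e z))) ⟨fun v => ?_, fun z => h2 _, ?_⟩
    · obtain ⟨u, hu⟩ := h1 v
      obtain ⟨z, rfl⟩ := hsurj u
      exact ⟨z, hu⟩
    · intro v v' z z' hv hv'
      have h := abs_sub_le_iff.1 (h3 _ _ _ _ hv hv')
      rw [he]
      generalize e z = a at *
      generalize e z' = b at *
      have hm := le_max_left (2 * dist q p) r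
      have hm' := le_max_right (2 * dist q p) r
      refine abs_sub_le_iff.2 ⟨by linarith [hd_lower a b], ?_⟩
      have hvn : 0 ≤ dist v v' := dist_nonneg
      rcases eq_or_ne a b with rfl | hab
      · rw [hd_self]
        linarith
      · rw [hd_ne a b hab, sub_le_iff_le_add]
        exact max_le (by linarith) (by linarith [hwr a, hwr b])

theorem exists_separated_of_card_lt (p W : GHSpace) [Finite W.Rep]
    (h : ¬(Finite p.Rep ∧ Nat.card p.Rep ≤ Nat.card W.Rep)) {r : ℝ} (hr : 0 < r) :
    ∃ Z : GHSpace, 2 * dist p Z < r ∧ r ≤ 2 * dist W Z ∧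
      ∀ q, 2 * dist q Z ≤ max (2 * dist q p) r := by
  rcases finite_or_infinite p.Rep with hf | hi
  · have hlt : Nat.card W.Rep < Nat.card p.Rep := by
      by_contra! hcon
      exact h ⟨hf, hcon⟩
    exact exists_separated p W (Finite.equivFin p.Rep).symm (Equiv.injective _) hlt hr
  · exact exists_separated p W (fun i : Fin (Nat.card W.Rep + 1) => Infinite.natEmbedding p.Rep i)
      ((Infinite.natEmbedding p.Rep).injective.comp Fin.val_injective) (Nat.lt_succ_self _) hr

theorem eq_onePoint_iff (p : GHSpace) :
    p = onePointGH ↔ ∀ q r, dist q r ≤ max (dist p q) (dist p r) := by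
  constructor
  · rintro rfl q r
    have h := two_mul_dist_le_max q r
    rw [ghDiam_eq, ghDiam_eq, ← mul_max_of_nonneg _ _ zero_le_two, dist_comm q onePointGH,
      dist_comm r onePointGH] at h
    linarith
  · intro h
    have := onePoint_subsingleton
    by_contra hne
    have hpos : 0 < dist p onePointGH := dist_pos.2 hne
    have hcard : ¬(Finite p.Rep ∧ Nat.card p.Rep ≤ Nat.card onePointGH.Rep) := by
      rintro ⟨hp, hcard⟩
      have : Subsingleton p.Rep := Finite.card_le_one_iff_subsingleton.1
        (hcard.trans (Finite.card_le_one_iff_subsingleton.2 this))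
      have h0 : ghDiam p ≤ 0 := ghDiam_le fun x y => by rw [Subsingleton.elim x y, dist_self]
      rw [ghDiam_eq] at h0
      linarith
    obtain ⟨Z, hZ1, hZ2, -⟩ := exists_separated_of_card_lt p onePointGH hcard
      (r := 4 * dist p onePointGH) (by positivity)
    have h' := h onePointGH Z
    rcases le_max_iff.1 h' with h' | h' <;> linarith

theorem map_onePoint (f : GHSpace ≃ᵢ GHSpace) : f onePointGH = onePointGH := by
  refine (eq_onePoint_iff _).2 fun q r => ?_
  have h := (eq_onePoint_iff onePointGH).1 rfl (f.symm q) (f.symm r)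
  rw [← f.dist_eq, ← f.dist_eq onePointGH, ← f.dist_eq onePointGH] at h
  simpa using h

theorem ghDiam_map (f : GHSpace ≃ᵢ GHSpace) (p : GHSpace) : ghDiam (f p) = ghDiam p := by
  rw [ghDiam_eq, ghDiam_eq, ← f.dist_eq p, map_onePoint]

/-- The class of a finite space whose distinct points are all at distance `t`, described
metrically among the classes of diameter at most `t`. -/
def IsExtremal (t : ℝ) (S : GHSpace) : Prop :=
  ghDiam S ≤ t ∧ ∀ q r, ghDiam q ≤ t → ghDiam r ≤ t → dist q r ≤ max (dist S q) (dist S r)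

theorem IsExtremal.map {t : ℝ} {S : GHSpace} (h : IsExtremal t S) (f : GHSpace ≃ᵢ GHSpace) :
    IsExtremal t (f S) := by
  refine ⟨(ghDiam_map f S).trans_le h.1, fun q r hq hr => ?_⟩
  have h' := h.2 (f.symm q) (f.symm r) (by rwa [ghDiam_map]) (by rwa [ghDiam_map])
  rw [← f.dist_eq, ← f.dist_eq S, ← f.dist_eq S] at h'
  simpa using h'

theorem exists_finite_image (p : GHSpace) (ψ : p.Rep → p.Rep) (hψ : (Set.range ψ).Finite) {c : ℝ}
    (h : ∀ x y, |dist x y - dist (ψ x) (ψ y)| ≤ c) :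
    ∃ W : GHSpace, Finite W.Rep ∧ Nat.card W.Rep = (Set.range ψ).ncard ∧ 2 * dist p W ≤ c ∧
      ghDiam W ≤ ghDiam p := by
  have : Finite (Set.range ψ) := hψ
  have : Nonempty (Set.range ψ) := (Set.range_nonempty ψ).to_subtype
  obtain ⟨W, e, he⟩ := exists_rep_finite (α := Set.range ψ) (fun a b => dist a b) dist_self
    dist_comm dist_triangle fun a b hab => dist_pos.2 hab
  refine ⟨W, Finite.of_equiv _ e.symm, Nat.card_congr e, ?_, ghDiam_le fun x y => ?_⟩
  · refine two_mul_dist_le (R := fun x w => ψ x = e w)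
      ⟨fun x => ⟨e.symm ⟨ψ x, x, rfl⟩, by simp⟩, fun w => (e w).2, fun x x' w w' hx hx' => ?_⟩
    rw [he, Subtype.dist_eq, ← hx, ← hx']
    exact h x x'
  · rw [he]
    exact dist_le_ghDiam p _ _

theorem IsExtremal.card_le {t : ℝ} (ht : 0 < t) {S W : GHSpace} (h : IsExtremal t S)
    [Finite W.Rep] (hW : ghDiam W ≤ t) (hd : 2 * dist S W < t) :
    Finite S.Rep ∧ Nat.card S.Rep ≤ Nat.card W.Rep := by
  by_contra hcard
  obtain ⟨Z, hZ1, hZ2, hZ3⟩ := exists_separated_of_card_lt S W hcard ht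
  have hZ : ghDiam Z ≤ t := by
    rw [ghDiam_eq, dist_comm]
    refine (hZ3 _).trans (max_le ?_ le_rfl)
    rw [dist_comm, ← ghDiam_eq]
    exact h.1
  rcases le_max_iff.1 (h.2 W Z hW hZ) with h' | h' <;> linarith

theorem IsExtremal.finite {t : ℝ} (ht : 0 < t) {S : GHSpace} (h : IsExtremal t S) :
    Finite S.Rep := by
  obtain ⟨F, hF, hcover⟩ := Metric.totallyBounded_iff.1
    (isCompact_univ (X := S.Rep)).totallyBounded (t / 8) (by positivity)
  have hψ : ∀ x, ∃ y ∈ F, dist x y < t / 8 := by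
    intro x
    simpa using hcover (Set.mem_univ x)
  choose ψ hψF hψ using hψ
  obtain ⟨W, hWf, -, hW, hWd⟩ := exists_finite_image S ψ
    (hF.subset (Set.range_subset_iff.2 hψF)) (c := t / 2) fun x y => by
      have := dist_dist_dist_le x y (ψ x) (ψ y)
      rw [Real.dist_eq] at this
      linarith [hψ x, hψ y]
  exact (h.card_le ht (hWd.trans h.1) (by linarith)).1

theorem IsExtremal.dist_eq {t : ℝ} (ht : 0 < t) {S : GHSpace} (h : IsExtremal t S)
    {a b : S.Rep} (hab : a ≠ b) : dist a b = t := by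
  classical
  refine le_antisymm ((dist_le_ghDiam S a b).trans h.1) ?_
  by_contra! hlt
  have := h.finite ht
  let ψ : S.Rep → S.Rep := fun x => if x = b then a else x
  obtain ⟨W, hWf, hWc, hW, hWd⟩ := exists_finite_image S ψ (Set.toFinite _) (c := dist a b)
    fun x y => by
      have h0 : 0 ≤ dist a b := dist_nonneg
      by_cases hx : x = b <;> by_cases hy : y = b
      · simp [ψ, hx, hy]
      · simp only [ψ, hx, hy, if_true, if_false]
        rw [dist_comm a b]
        exact abs_dist_sub_le b a y
      · simp only [ψ, hx, hy, if_true, if_false]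
        rw [dist_comm a b, dist_comm x, dist_comm x]
        exact abs_dist_sub_le b a x
      · simp [ψ, hx, hy, h0]
  have hle := (h.card_le ht (hWd.trans h.1) (hW.trans_lt hlt)).2
  have hsub : Set.range ψ ⊂ Set.univ := by
    refine Set.ssubset_univ_iff.2 fun huniv => ?_
    obtain ⟨x, hx⟩ : b ∈ Set.range ψ := huniv ▸ Set.mem_univ b
    by_cases hxb : x = b
    · simp only [ψ, hxb, if_true] at hx
      exact hab hx
    · simp only [ψ, hxb, if_false] at hx
  have hlt' := Set.ncard_lt_ncard hsub
  rw [Set.ncard_univ, ← hWc] at hlt'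
  exact hlt'.not_ge hle

theorem isExtremal_of_dist_eq {t : ℝ} (ht : 0 < t) {S : GHSpace}
    (h : ∀ a b : S.Rep, a ≠ b → dist a b = t) : IsExtremal t S := by
  have hS : ghDiam S ≤ t := ghDiam_le fun a b => by
    rcases eq_or_ne a b with rfl | hab
    · rw [dist_self]
      exact ht.le
    · exact (h a b hab).le
  refine ⟨hS, fun q r hq hr => ?_⟩
  have hqr := (two_mul_dist_le_max q r).trans (max_le hq hr)
  by_cases hSq : t ≤ 2 * dist S q
  · exact le_max_of_le_left (by linarith)
  by_cases hSr : t ≤ 2 * dist S r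
  · exact le_max_of_le_right (by linarith)
  push Not at hSq hSr
  have hsep : ∀ c < t, ∀ a b : S.Rep, dist a b ≤ c → a = b := by
    intro c hc a b hle
    by_contra hab
    rw [h a b hab] at hle
    linarith
  obtain ⟨R, hR⟩ := exists_isCorr S q
  obtain ⟨R', hR'⟩ := exists_isCorr S r
  obtain ⟨a, ha, had⟩ := exists_label hR (hsep _ hSq)
  obtain ⟨b, hb, hbd⟩ := exists_label hR' (hsep _ hSr)
  have hmax : 2 * dist q r ≤ max (2 * dist S q) (2 * dist S r) := by
    refine two_mul_dist_le (isCorr_of_labels ha hb fun y y' z z' hz hz' => ?_)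
    have hy := abs_sub_le_iff.1 (had y y')
    have hz := abs_sub_le_iff.1 (hbd z z')
    have h1 := le_max_left (2 * dist S q) (2 * dist S r)
    have h2 := le_max_right (2 * dist S q) (2 * dist S r)
    have hyn : 0 ≤ dist y y' := dist_nonneg
    have hzn : 0 ≤ dist z z' := dist_nonneg
    have hyt := (dist_le_ghDiam q y y').trans hq
    have hzt := (dist_le_ghDiam r z z').trans hr
    rcases eq_or_ne (a y) (a y') with heq | hne
    · have heq' : b z = b z' := by simp_all
      rw [heq, dist_self] at hy
      rw [heq', dist_self] at hz
      exact abs_sub_le_iff.2 ⟨by linarith, by linarith⟩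
    · have hne' : b z ≠ b z' := by simp_all
      rw [h _ _ hne] at hy
      rw [h _ _ hne'] at hz
      exact abs_sub_le_iff.2 ⟨by linarith, by linarith⟩
  rw [← mul_max_of_nonneg _ _ zero_le_two] at hmax
  linarith

theorem IsExtremal.eq_of_card {t : ℝ} (ht : 0 < t) {S S' : GHSpace} (h : IsExtremal t S)
    (h' : IsExtremal t S') (hc : Nat.card S.Rep = Nat.card S'.Rep) : S = S' := by
  have := h.finite ht
  have := h'.finite ht
  let e := (Finite.equivFinOfCardEq hc).trans (Finite.equivFin _).symm
  have hle : 2 * dist S S' ≤ 0 := by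
    refine two_mul_dist_le (R := fun x y => e x = y)
      ⟨fun x => ⟨_, rfl⟩, fun y => e.surjective y, ?_⟩
    rintro x x' _ _ rfl rfl
    rcases eq_or_ne x x' with rfl | hx
    · simp
    · rw [h.dist_eq ht hx, h'.dist_eq ht (e.injective.ne hx)]
      simp
  exact dist_le_zero.1 (by linarith)

theorem exists_isExtremal {t : ℝ} (ht : 0 < t) {m : ℕ} (hm : 0 < m) :
    ∃ S, IsExtremal t S ∧ Nat.card S.Rep = m := by
  have : Nonempty (Fin m) := ⟨⟨0, hm⟩⟩
  obtain ⟨S, e, he⟩ := exists_rep_finite (α := Fin m) (fun i j => if i = j then 0 else t)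
    (simplexMetric m t ht).dist_self (simplexMetric m t ht).dist_comm
    (simplexMetric m t ht).dist_triangle fun a b hab => by simpa [hab] using ht
  refine ⟨S, isExtremal_of_dist_eq ht fun a b hab => ?_, by rw [Nat.card_congr e, Nat.card_fin]⟩
  rw [he, if_neg (e.injective.ne hab)]

theorem IsExtremal.dist_lt_iff {t : ℝ} {S X : GHSpace} (h : IsExtremal t S) [Finite X.Rep]
    (hX : ghDiam X < t) : 2 * dist S X < t ↔ Nat.card S.Rep ≤ Nat.card X.Rep := by
  have ht := (ghDiam_nonneg X).trans_lt hX
  have := h.finite ht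
  constructor
  · intro hlt
    obtain ⟨R, hR⟩ := exists_isCorr S X
    obtain ⟨a, ha, -⟩ := exists_label hR fun x y hle => by
      by_contra hxy
      rw [h.dist_eq ht hxy] at hle
      linarith
    exact Nat.card_le_card_of_surjective a ha
  · intro hle
    obtain ⟨a, ha⟩ : ∃ a : X.Rep → S.Rep, Function.Surjective a := by
      have := Fintype.ofFinite S.Rep
      have := Fintype.ofFinite X.Rep
      rw [Nat.card_eq_fintype_card, Nat.card_eq_fintype_card] at hle
      obtain ⟨i⟩ := Function.Embedding.nonempty_of_card_le hle
      exact ⟨_, Function.invFun_surjective i.injective⟩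
    obtain ⟨⟨x₀, y₀⟩, hmax⟩ := Finite.exists_max fun z : X.Rep × X.Rep =>
      |dist (a z.1) (a z.2) - dist z.1 z.2|
    refine (two_mul_dist_le (R := fun s x => s = a x) (c := |dist (a x₀) (a y₀) - dist x₀ y₀|)
      ⟨fun s => (ha s).imp fun _ h => h.symm, fun x => ⟨_, rfl⟩, ?_⟩).trans_lt ?_
    · rintro _ _ x x' rfl rfl
      exact hmax (x, x')
    · have hlt := (dist_le_ghDiam X x₀ y₀).trans_lt hX
      rcases eq_or_ne (a x₀) (a y₀) with heq | hne
      · rw [heq, dist_self, zero_sub, abs_neg, abs_of_nonneg dist_nonneg]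
        exact hlt
      · have hpos : 0 < dist x₀ y₀ := dist_pos.2 fun h => hne (congrArg a h)
        rw [h.dist_eq ht hne]
        exact abs_sub_lt_iff.2 ⟨by linarith, by linarith⟩

theorem ncard_isExtremal {t : ℝ} {X : GHSpace} [Finite X.Rep] (hX : ghDiam X < t) :
    {S | IsExtremal t S ∧ 2 * dist S X < t}.ncard = Nat.card X.Rep := by
  have ht := (ghDiam_nonneg X).trans_lt hX
  have hinj : Set.InjOn (fun S : GHSpace => Nat.card S.Rep)
      {S | IsExtremal t S ∧ 2 * dist S X < t} :=
    fun S hS S' hS' hc => hS.1.eq_of_card ht hS'.1 hc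
  have himage : (fun S : GHSpace => Nat.card S.Rep) '' {S | IsExtremal t S ∧ 2 * dist S X < t} =
      Finset.Icc 1 (Nat.card X.Rep) := by
    ext m
    rw [Finset.coe_Icc]
    constructor
    · rintro ⟨S, ⟨hS, hd⟩, rfl⟩
      have := hS.finite ht
      exact ⟨Nat.card_pos, (hS.dist_lt_iff hX).1 hd⟩
    · rintro ⟨hm, hm'⟩
      obtain ⟨S, hS, rfl⟩ := exists_isExtremal ht (Nat.lt_of_lt_of_le one_pos hm)
      exact ⟨S, ⟨hS, (hS.dist_lt_iff hX).2 hm'⟩, rfl⟩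
  rw [← hinj.ncard_image, himage, Set.ncard_coe_finset, Nat.card_Icc,
    Nat.add_sub_cancel]

theorem card_map (f : GHSpace ≃ᵢ GHSpace) (X : GHSpace) [Finite X.Rep] [Finite (f X).Rep] :
    Nat.card (f X).Rep = Nat.card X.Rep := by
  have hX : ghDiam X < ghDiam X + 1 := lt_add_one _
  rw [← ncard_isExtremal hX, ← ncard_isExtremal ((ghDiam_map f X).trans_lt hX),
    ← Set.ncard_image_of_injective {S | IsExtremal (ghDiam X + 1) S ∧ 2 * dist S X < ghDiam X + 1}
      f.injective]
  congr 1
  ext S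
  constructor
  · rintro ⟨hS, hd⟩
    refine ⟨f.symm S, ⟨hS.map f.symm, ?_⟩, f.apply_symm_apply S⟩
    rwa [← f.dist_eq, f.apply_symm_apply]
  · rintro ⟨S, ⟨hS, hd⟩, rfl⟩
    refine ⟨hS.map f, ?_⟩
    rwa [f.dist_eq]

/-- A one-sided ultrametric inequality near `X`, within a ball having `X` on its boundary. -/
def IsCorner (X : GHSpace) : Prop :=
  ∃ V, X ≠ V ∧ ∃ r, 0 < r ∧ ∀ Y Z, dist V Y ≤ dist V X → dist V Z ≤ dist V X →
    dist X Y < r → dist X Z < r → dist Y Z ≤ max (dist X Y) (dist X Z)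

theorem IsCorner.map {X : GHSpace} (h : IsCorner X) (f : GHSpace ≃ᵢ GHSpace) :
    IsCorner (f X) := by
  obtain ⟨V, hV, r, hr, h⟩ := h
  refine ⟨f V, f.injective.ne hV, r, hr, fun Y Z => ?_⟩
  obtain ⟨Y, rfl⟩ := f.surjective Y
  obtain ⟨Z, rfl⟩ := f.surjective Z
  simpa only [f.dist_eq] using h Y Z

/-- Finite spaces approximate `X` from the side of `V`. -/
theorem exists_finite_between {X V : GHSpace} (hXV : X ≠ V) {ρ : ℝ} (hρ : 0 < ρ) :
    ∃ W : GHSpace, Finite W.Rep ∧ dist V W ≤ dist V X ∧ 2 * dist X W < ρ := by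
  obtain ⟨R, hR1, hR2, hR3⟩ := exists_isCorr X V
  have hD : 0 < 2 * dist X V := by have := dist_pos.2 hXV; positivity
  set D := 2 * dist X V with hD_def
  obtain ⟨l, hl0, hl1, hlρ⟩ : ∃ l : ℝ, 0 < l ∧ l < 1 ∧ 2 * (l * D) < ρ := by
    refine ⟨min (1 / 2) (ρ / (4 * D)), by positivity, by
      exact (min_le_left _ _).trans_lt (by norm_num), ?_⟩
    have h1 : min (1 / 2) (ρ / (4 * D)) * D ≤ ρ / (4 * D) * D := by
      gcongr
      exact min_le_right _ _
    have h2 : ρ / (4 * D) * D = ρ / 4 := by field_simp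
    linarith
  have hη : 0 < l * D / 2 := by positivity
  obtain ⟨F, hFR, hF, hcover⟩ := totallyBounded_iff_subset.1
    ((isCompact_univ (X := X.Rep × V.Rep)).totallyBounded.subset
      (Set.subset_univ {z | R z.1 z.2})) _ (Metric.dist_mem_uniformity hη)
  have hnet : ∀ x v, R x v → ∃ z : F, dist x z.1.1 < l * D / 2 ∧ dist v z.1.2 < l * D / 2 := by
    intro x v hxv
    have := hcover (show (x, v) ∈ {z : X.Rep × V.Rep | R z.1 z.2} from hxv)
    simp only [Set.mem_iUnion] at this
    obtain ⟨z, hz, hd⟩ := this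
    change dist (x, v) z < l * D / 2 at hd
    rw [Prod.dist_eq] at hd
    exact ⟨⟨z, hz⟩, max_lt_iff.1 hd⟩
  have : Finite F := hF
  have : Nonempty F := by
    obtain ⟨x⟩ : Nonempty X.Rep := inferInstance
    obtain ⟨v, hv⟩ := hR1 x
    exact (hnet x v hv).nonempty
  obtain ⟨W, e, he⟩ := exists_rep_finite (α := F)
    (fun a b => (1 - l) * dist a.1.1 b.1.1 + l * dist a.1.2 b.1.2) (by simp)
    (fun a b => by simp only [dist_comm]) (fun a b c => by
      have h1 := mul_le_mul_of_nonneg_left (dist_triangle a.1.1 b.1.1 c.1.1) (sub_pos.2 hl1).le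
      have h2 := mul_le_mul_of_nonneg_left (dist_triangle a.1.2 b.1.2 c.1.2) hl0.le
      linarith) (fun a b hab => by
      have hl1' : 0 < 1 - l := sub_pos.2 hl1
      by_cases h1 : a.1.1 = b.1.1
      · have h2 : a.1.2 ≠ b.1.2 := fun h2 => hab (Subtype.ext (Prod.ext h1 h2))
        have := dist_pos.2 h2
        positivity
      · have := dist_pos.2 h1
        positivity)
  refine ⟨W, Finite.of_equiv _ e.symm, ?_, ?_⟩
  · suffices h : 2 * dist V W ≤ D by
      rw [dist_comm V X]
      linarith
    refine two_mul_dist_le (R := fun v w => dist v (e w).1.2 ≤ l * D / 2)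
      ⟨fun v => ?_, fun w => ⟨(e w).1.2, by simpa using hη.le⟩, fun v v' w w' hv hv' => ?_⟩
    · obtain ⟨x, hx⟩ := hR2 v
      obtain ⟨z, -, hz⟩ := hnet x v hx
      exact ⟨e.symm z, by simpa using hz.le⟩
    · have h1 := dist_dist_dist_le v v' (e w).1.2 (e w').1.2
      have h2 := abs_sub_le_iff.1 (hR3 _ _ _ _ (hFR (e w).2) (hFR (e w').2))
      rw [Real.dist_eq] at h1
      have h3 := abs_sub_le_iff.1 h1
      rw [he]
      have h4 := mul_le_mul_of_nonneg_left h2.1 (sub_pos.2 hl1).le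
      have h5 := mul_le_mul_of_nonneg_left h2.2 (sub_pos.2 hl1).le
      exact abs_sub_le_iff.2 ⟨by linarith, by linarith⟩
  · refine lt_of_le_of_lt ?_ hlρ
    refine two_mul_dist_le (R := fun x w => dist x (e w).1.1 ≤ l * D / 2)
      ⟨fun x => ?_, fun w => ⟨(e w).1.1, by simpa using hη.le⟩, fun x x' w w' hx hx' => ?_⟩
    · obtain ⟨v, hv⟩ := hR1 x
      obtain ⟨z, hz, -⟩ := hnet x v hv
      exact ⟨e.symm z, by simpa using hz.le⟩
    · have h1 := dist_dist_dist_le x x' (e w).1.1 (e w').1.1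
      have h2 := abs_sub_le_iff.1 (hR3 _ _ _ _ (hFR (e w).2) (hFR (e w').2))
      rw [Real.dist_eq] at h1
      have h3 := abs_sub_le_iff.1 h1
      rw [he]
      have h4 := mul_le_mul_of_nonneg_left h2.1 hl0.le
      have h5 := mul_le_mul_of_nonneg_left h2.2 hl0.le
      exact abs_sub_le_iff.2 ⟨by linarith, by linarith⟩

theorem IsCorner.finite {X : GHSpace} (h : IsCorner X) : Finite X.Rep := by
  obtain ⟨V, hV, r, hr, h⟩ := h
  by_contra hinf
  have hD : 0 < dist V X := dist_pos.2 hV.symm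
  have hm : 0 < min (2 * r) (2 * dist V X) := by positivity
  have hm1 := min_le_left (2 * r) (2 * dist V X)
  have hm2 := min_le_right (2 * r) (2 * dist V X)
  obtain ⟨W, hWf, hVW, hXW⟩ := exists_finite_between hV hm
  obtain ⟨Z, hXZ, hWZ, hZ⟩ := exists_separated_of_card_lt X W (fun h => hinf h.1) hm
  have hVZ := (hZ V).trans (max_le le_rfl hm2)
  rcases le_max_iff.1 (h W Z hVW (by linarith) (by linarith) (by linarith)) with h' | h' <;>
    linarith

theorem isCorner_of_finite (X : GHSpace) [Finite X.Rep] [Nontrivial X.Rep] : IsCorner X := by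
  classical
  obtain ⟨V, e, he⟩ := exists_rep_finite (α := X.Rep)
    (fun a b => if a = b then 0 else dist a b + 1) (by simp)
    (fun a b => by simp only [dist_comm, eq_comm])
    (fun a b c => by
      have h1 := dist_triangle a b c
      have h2 : 0 ≤ dist a b := dist_nonneg
      have h3 : 0 ≤ dist b c := dist_nonneg
      by_cases hab : a = b
      · subst hab
        simp
      by_cases hbc : b = c
      · subst hbc
        simp
      rw [if_neg hab, if_neg hbc]
      split_ifs <;> linarith)
    (fun a b hab => by
      rw [if_neg hab]
      positivity)
  have hVX : 2 * dist V X = 1 := by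
    refine le_antisymm ?_ ?_
    · refine two_mul_dist_le (R := fun v x => e v = x)
        ⟨fun v => ⟨_, rfl⟩, fun x => e.surjective x, ?_⟩
      rintro v v' _ _ rfl rfl
      rw [he]
      split_ifs with h
      · simp [h]
      · simp
    · obtain ⟨⟨a, b⟩, hmax⟩ := Finite.exists_max fun z : X.Rep × X.Rep => dist z.1 z.2
      obtain ⟨x, y, hxy⟩ := exists_pair_ne X.Rep
      have hab : a ≠ b := dist_pos.1 ((dist_pos.2 hxy).trans_le (hmax (x, y)))
      obtain ⟨R, h1, -, h3⟩ := exists_isCorr V X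
      obtain ⟨a', ha⟩ := h1 (e.symm a)
      obtain ⟨b', hb⟩ := h1 (e.symm b)
      have h := (le_abs_self _).trans (h3 _ _ _ _ ha hb)
      rw [he, e.apply_symm_apply, e.apply_symm_apply, if_neg hab] at h
      have := hmax (a', b')
      dsimp only at this
      linarith
  obtain ⟨g, hg, hgap⟩ := exists_pos_le fun z : (X.Rep × X.Rep) × (X.Rep × X.Rep) =>
    dist z.1.1 z.1.2 - dist z.2.1 z.2.2
  have hgap' : ∀ a b i j : X.Rep, dist a b < dist i j + g → dist a b ≤ dist i j := by
    intro a b i j hlt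
    by_contra! hcon
    have := hgap ((a, b), (i, j)) (sub_pos.2 hcon)
    dsimp only at this
    linarith
  have hlabel : ∀ Y, 2 * dist V Y ≤ 1 → 2 * dist X Y < g → ∃ a : Y.Rep → X.Rep,
      Function.Surjective a ∧ ∀ y y', dist (a y) (a y') ≤ dist y y' ∧
        dist y y' ≤ dist (a y) (a y') + 2 * dist X Y := by
    intro Y hVY hXY
    obtain ⟨R, hR⟩ := exists_isCorr V Y
    obtain ⟨a, ha, had⟩ := exists_label hR fun v w hvw => by
      by_contra hne
      have hne' := e.injective.ne hne
      rw [he, if_neg hne'] at hvw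
      linarith [dist_pos.2 hne']
    have hlow : ∀ y y', dist (e (a y)) (e (a y')) ≤ dist y y' := by
      intro y y'
      rcases eq_or_ne (e (a y)) (e (a y')) with heq | hne
      · rw [heq, dist_self]
        exact dist_nonneg
      · have := (abs_sub_le_iff.1 (had y y')).1
        rw [he, if_neg hne] at this
        linarith
    obtain ⟨R', h1, h2, h3⟩ := exists_isCorr X Y
    choose s hs using h1
    have hπ : ∀ i y, R' i y → e (a y) = e (a (s i)) := by
      intro i y hy
      have h := (abs_sub_le_iff.1 (h3 _ _ _ _ hy (hs i))).2
      rw [dist_self, sub_zero] at h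
      have := hgap' (e (a y)) (e (a (s i))) i i (by
        rw [dist_self]
        linarith [hlow y (s i)])
      rw [dist_self] at this
      exact dist_le_zero.1 this
    have hsurj : Function.Surjective fun i => e (a (s i)) := by
      intro x
      obtain ⟨y, hy⟩ := ha (e.symm x)
      obtain ⟨i, hi⟩ := h2 y
      exact ⟨i, by
        beta_reduce
        rw [← hπ i y hi, hy, e.apply_symm_apply]⟩
    let σ : X.Rep ≃ X.Rep := Equiv.ofBijective _ (Finite.injective_iff_bijective.1
      (Finite.injective_iff_surjective.2 hsurj))
    have hσ_le : ∀ i j, dist (σ i) (σ j) ≤ dist i j := fun i j => hgap' _ _ _ _ (by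
      have h := (abs_sub_le_iff.1 (h3 _ _ _ _ (hs i) (hs j))).2
      have := hlow (s i) (s j)
      change dist (e (a (s i))) (e (a (s j))) < _
      linarith)
    have hσ : ∀ i j, dist (σ i) (σ j) = dist i j := by
      have := Fintype.ofFinite X.Rep
      have hsum : ∑ z : X.Rep × X.Rep, dist (σ z.1) (σ z.2) = ∑ z : X.Rep × X.Rep, dist z.1 z.2 :=
        Equiv.sum_comp (σ.prodCongr σ) fun z => dist z.1 z.2
      have := (Finset.sum_eq_sum_iff_of_le fun z _ => hσ_le z.1 z.2).1 hsum
      exact fun i j => this (i, j) (Finset.mem_univ _)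
    refine ⟨fun y => e (a y), e.surjective.comp ha, fun y y' => ⟨hlow y y', ?_⟩⟩
    obtain ⟨i, hi⟩ := h2 y
    obtain ⟨j, hj⟩ := h2 y'
    have h := (abs_sub_le_iff.1 (h3 _ _ _ _ hi hj)).2
    have hij := hσ i j
    change dist (e (a (s i))) (e (a (s j))) = _ at hij
    rw [← hπ i y hi, ← hπ j y' hj] at hij
    linarith
  refine ⟨V, fun h => by simp [h] at hVX, g / 2, half_pos hg, fun Y Z hVY hVZ hXY hXZ => ?_⟩
  obtain ⟨a, ha, had⟩ := hlabel Y (by linarith) (by linarith)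
  obtain ⟨b, hb, hbd⟩ := hlabel Z (by linarith) (by linarith)
  have hmax : 2 * dist Y Z ≤ max (2 * dist X Y) (2 * dist X Z) := by
    refine two_mul_dist_le (isCorr_of_labels ha hb fun y y' z z' hz hz' => ?_)
    have h1 := le_max_left (2 * dist X Y) (2 * dist X Z)
    have h2 := le_max_right (2 * dist X Y) (2 * dist X Z)
    have hy := had y y'
    have hz'' := hbd z z'
    rw [hz, hz'] at hy
    exact abs_sub_le_iff.2 ⟨by linarith, by linarith⟩
  rw [← mul_max_of_nonneg _ _ zero_le_two] at hmax
  linarith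

theorem finite_map (f : GHSpace ≃ᵢ GHSpace) (X : GHSpace) [Finite X.Rep] :
    Finite (f X).Rep := by
  rcases subsingleton_or_nontrivial X.Rep with hs | hn
  · have h0 : ghDiam X ≤ 0 := ghDiam_le fun x y => by rw [Subsingleton.elim x y, dist_self]
    have : Subsingleton (f X).Rep := ⟨fun x y => dist_le_zero.1
      ((dist_le_ghDiam _ x y).trans ((ghDiam_map f X).trans_le h0))⟩
    infer_instance
  · exact ((isCorner_of_finite X).map f).finite

end GHIsometry

/-- Every surjective isometry of the Gromov–Hausdorff space takes each class of an
`n`-point metric space to a class of an `n`-point metric space of the same diameter. -/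
theorem ghspace_isometry_preserves_card
    (f : GromovHausdorff.GHSpace ≃ᵢ GromovHausdorff.GHSpace)
    (n : ℕ) (hn : 0 < n) (X : GromovHausdorff.GHSpace) (hX : Nat.card X.Rep = n) :
    Nat.card (f X).Rep = n ∧ ghDiam (f X) = ghDiam X := by
  have : Finite X.Rep := Nat.finite_of_card_ne_zero (by omega)
  have := GHIsometry.finite_map f X
  exact ⟨(GHIsometry.card_map f X).trans hX, GHIsometry.ghDiam_map f X⟩
end

section
/- For every integer n ≥ 4, the set C_n^g of generic metric vectors on n points is path-connected; moreover, any two points of C_n^g can be joined by a polygonal line (a finite concatenation of straight segments) lying entirely in C_n^g. -/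
/-- `d : Fin n → Fin n → ℝ` is a metric vector: zero on the diagonal, symmetric, positive
off the diagonal, and satisfying all triangle inequalities. -/
def IsMetricVector {n : ℕ} (d : Fin n → Fin n → ℝ) : Prop :=
  (∀ i, d i i = 0) ∧ (∀ i j, d i j = d j i) ∧ (∀ i j, i ≠ j → 0 < d i j) ∧
  (∀ i j k, d i k ≤ d i j + d j k)

/-- A metric vector is generic (in general position): all triangle inequalities on
pairwise distinct indices are strict, and the only permutation preserving it is the
identity. -/
def IsGenericMetricVector {n : ℕ} (d : Fin n → Fin n → ℝ) : Prop :=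
  IsMetricVector d ∧
  (∀ i j k : Fin n, i ≠ j → j ≠ k → i ≠ k → d i k < d i j + d j k) ∧
  (∀ σ : Equiv.Perm (Fin n), (∀ i j, d (σ i) (σ j) = d i j) → σ = 1)

/-- The set `C_n^g` of generic metric vectors on `n` points. -/
def genericMetricVectors (n : ℕ) : Set (Fin n → Fin n → ℝ) :=
  { d | IsGenericMetricVector d }

open Filter Topology

/-- The functions on pairs that are symmetric and vanish on the diagonal. -/
def symmetricHollow (n : ℕ) : Submodule ℝ (Fin n → Fin n → ℝ) where
  carrier := { d | (∀ i, d i i = 0) ∧ ∀ i j, d i j = d j i }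
  zero_mem' := by simp
  add_mem' := by
    rintro a b ⟨ha, ha'⟩ ⟨hb, hb'⟩
    refine ⟨fun i => by simp [ha, hb], fun i j => ?_⟩
    simp only [Pi.add_apply]
    rw [ha' i j, hb' i j]
  smul_mem' := by
    rintro c a ⟨ha, ha'⟩
    refine ⟨fun i => by simp [ha], fun i j => ?_⟩
    simp only [Pi.smul_apply]
    rw [ha' i j]

/-- The non-degenerate metric vectors: all triangle inequalities on pairwise distinct indices
are strict. -/
def strictMetricVectors (n : ℕ) : Set (Fin n → Fin n → ℝ) :=
  { d | d ∈ symmetricHollow n ∧ (∀ i j, i ≠ j → 0 < d i j) ∧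
    ∀ i j k, i ≠ j → j ≠ k → i ≠ k → d i k < d i j + d j k }

theorem mem_genericMetricVectors_iff {n : ℕ} {d : Fin n → Fin n → ℝ} :
    d ∈ genericMetricVectors n ↔ d ∈ strictMetricVectors n ∧
      ∀ σ : Equiv.Perm (Fin n), (∀ i j, d (σ i) (σ j) = d i j) → σ = 1 := by
  constructor
  · rintro ⟨⟨h0, hs, hp, -⟩, ht, hr⟩
    exact ⟨⟨⟨h0, hs⟩, hp, ht⟩, hr⟩
  · rintro ⟨⟨⟨h0, hs⟩, hp, ht⟩, hr⟩
    refine ⟨⟨h0, hs, hp, fun i j k => ?_⟩, ht, hr⟩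
    have hnonneg : ∀ i j, 0 ≤ d i j := fun i j => by
      by_cases h : i = j
      · rw [h, h0]
      · exact (hp i j h).le
    by_cases hij : i = j
    · subst hij; simp [h0]
    by_cases hjk : j = k
    · subst hjk; simp [h0]
    by_cases hik : i = k
    · subst hik
      rw [h0]
      exact add_nonneg (hnonneg _ _) (hnonneg _ _)
    exact (ht i j k hij hjk hik).le

theorem convex_strictMetricVectors (n : ℕ) : Convex ℝ (strictMetricVectors n) := by
  rintro x ⟨hxV, hxp, hxt⟩ y ⟨hyV, hyp, hyt⟩ a b ha hb hab
  have key : ∀ u v : ℝ, 0 < u → 0 < v → 0 < a * u + b * v := by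
    intro u v hu hv
    rcases ha.eq_or_lt with rfl | ha
    · have : b = 1 := by linarith
      simpa [this]
    · have := mul_pos ha hu
      have := mul_nonneg hb hv.le
      linarith
  refine ⟨add_mem (Submodule.smul_mem _ _ hxV) (Submodule.smul_mem _ _ hyV),
    fun i j hij => ?_, fun i j k hij hjk hik => ?_⟩
  · simpa using key _ _ (hxp i j hij) (hyp i j hij)
  · have := key _ _ (sub_pos.2 (hxt i j k hij hjk hik)) (sub_pos.2 (hyt i j k hij hjk hik))
    simp only [Pi.add_apply, Pi.smul_apply, smul_eq_mul]
    linarith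

theorem one_off_diagonal_mem_strictMetricVectors (n : ℕ) :
    (fun i j : Fin n => if i = j then (0 : ℝ) else 1) ∈ strictMetricVectors n := by
  refine ⟨⟨fun i => by simp, fun i j => by simp [eq_comm]⟩, fun i j hij => by simp [hij],
    fun i j k hij hjk hik => by simp [hij, hjk, hik]⟩

/-- Non-degeneracy is stable under small perturbations within the symmetric hollow functions. -/
theorem eventually_add_smul_mem_strictMetricVectors {n : ℕ} {x v : Fin n → Fin n → ℝ}
    (hx : x ∈ strictMetricVectors n) (hv : v ∈ symmetricHollow n) :
    ∀ᶠ ε : ℝ in 𝓝 0, x + ε • v ∈ strictMetricVectors n := by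
  obtain ⟨hxV, hxp, hxt⟩ := hx
  have hc : ∀ i j, Tendsto (fun ε : ℝ => (x + ε • v) i j) (𝓝 0) (𝓝 (x i j)) := fun i j => by
    have : Continuous fun ε : ℝ => (x + ε • v) i j := by
      simp only [Pi.add_apply, Pi.smul_apply]
      fun_prop
    simpa using this.tendsto 0
  have hp : ∀ᶠ ε : ℝ in 𝓝 0, ∀ i j, i ≠ j → 0 < (x + ε • v) i j := by
    simp only [eventually_all]
    exact fun i j hij => (hc i j).eventually_const_lt (hxp i j hij)
  have ht : ∀ᶠ ε : ℝ in 𝓝 0, ∀ i j k, i ≠ j → j ≠ k → i ≠ k →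
      (x + ε • v) i k < (x + ε • v) i j + (x + ε • v) j k := by
    simp only [eventually_all]
    exact fun i j k hij hjk hik =>
      (hc i k).eventually_lt ((hc i j).add (hc j k)) (hxt i j k hij hjk hik)
  filter_upwards [hp, ht] with ε hp ht
  exact ⟨add_mem hxV (Submodule.smul_mem _ _ hv), hp, ht⟩

/-- A line whose direction is not in a subspace leaves it immediately. -/
theorem eventually_add_smul_notMem {E : Type*} [AddCommGroup E] [Module ℝ E]
    (W : Submodule ℝ E) (x : E) {v : E} (hv : v ∉ W) :
    ∀ᶠ ε : ℝ in 𝓝[≠] 0, x + ε • v ∉ W := by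
  have hs : Set.Subsingleton { ε : ℝ | x + ε • v ∈ W } := by
    intro a ha b hb
    by_contra hab
    have h : (a - b) • v ∈ W := by
      have := W.sub_mem ha hb
      rwa [add_sub_add_left_eq_sub, ← sub_smul] at this
    exact hv ((W.smul_mem_iff (sub_ne_zero.2 hab)).1 h)
  rcases hs.eq_empty_or_singleton with h | ⟨a, h⟩
  · exact Eventually.of_forall fun ε hε => (Set.ext_iff.1 h ε).1 hε
  · have hiff : ∀ ε : ℝ, x + ε • v ∈ W ↔ ε = a := fun ε => by
      simpa using Set.ext_iff.1 h ε
    simp only [hiff]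
    by_cases ha : a = 0
    · subst ha
      exact eventually_mem_nhdsWithin
    · exact eventually_ne_nhdsWithin (Ne.symm ha)

/-- Finitely many proper subspaces do not cover the non-degenerate metric vectors. -/
theorem exists_strictMetricVector_notMem {n : ℕ} {ι : Type*} [Finite ι]
    (W : ι → Submodule ℝ (Fin n → Fin n → ℝ)) (hW : ∀ i, ¬ symmetricHollow n ≤ W i) :
    ∃ z ∈ strictMetricVectors n, ∀ i, z ∉ W i := by
  obtain ⟨v, hv⟩ : ∃ v : symmetricHollow n, ∀ i, (v : Fin n → Fin n → ℝ) ∉ W i := by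
    by_contra! hcov
    obtain ⟨i, hi⟩ := Subspace.exists_eq_top_of_iUnion_eq_univ
      (p := fun i => (W i).comap (symmetricHollow n).subtype)
      (Set.eq_univ_of_forall fun v => Set.mem_iUnion.2 (hcov v))
    exact hW i (Submodule.comap_subtype_eq_top.1 hi)
  have hK := (eventually_add_smul_mem_strictMetricVectors
    (one_off_diagonal_mem_strictMetricVectors n) v.2).filter_mono
    (nhdsWithin_le_nhds (s := {0}ᶜ))
  obtain ⟨ε, h1, h2⟩ := (hK.and
    (eventually_all.2 fun i => eventually_add_smul_notMem (W i) _ (hv i))).exists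
  exact ⟨_, h1, h2⟩

/-- The defect `d i j - d (σ i) (σ j)` of invariance under a permutation. -/
def permDefect {n : ℕ} (σ : Equiv.Perm (Fin n)) (p : Fin n × Fin n) :
    (Fin n → Fin n → ℝ) →ₗ[ℝ] ℝ where
  toFun d := d p.1 p.2 - d (σ p.1) (σ p.2)
  map_add' a b := by simp only [Pi.add_apply]; ring
  map_smul' c a := by simp only [Pi.smul_apply, smul_eq_mul, RingHom.id_apply]; ring

/-- The functions whose defect under `σ` is proportional to that of `x`. -/
def proportionalDefect {n : ℕ} (σ : Equiv.Perm (Fin n)) (x : Fin n → Fin n → ℝ) :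
    Submodule ℝ (Fin n → Fin n → ℝ) :=
  ⨅ p, ⨅ q, LinearMap.ker (permDefect σ q x • permDefect σ p - permDefect σ p x • permDefect σ q)

theorem mem_proportionalDefect {n : ℕ} {σ : Equiv.Perm (Fin n)} {x z : Fin n → Fin n → ℝ} :
    z ∈ proportionalDefect σ x ↔
      ∀ p q, permDefect σ q x * permDefect σ p z = permDefect σ p x * permDefect σ q z := by
  simp [proportionalDefect, sub_eq_zero]

theorem permDefect_eq_zero_iff {n : ℕ} {σ : Equiv.Perm (Fin n)} {d : Fin n → Fin n → ℝ} :
    (∀ p, permDefect σ p d = 0) ↔ ∀ i j, d (σ i) (σ j) = d i j := by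
  simp only [permDefect, LinearMap.coe_mk, AddHom.coe_mk, sub_eq_zero, Prod.forall]
  exact forall₂_congr fun _ _ => eq_comm

/-- For `n ≥ 4`, a nontrivial permutation of the points imposes at least two independent
conditions on the functions it preserves. -/
theorem exists_independent_permDefect {n : ℕ} (hn : 4 ≤ n) {σ : Equiv.Perm (Fin n)}
    (hσ : σ ≠ 1) :
    ∃ u ∈ symmetricHollow n, ∃ v ∈ symmetricHollow n, ∃ p q,
      permDefect σ p u = 1 ∧ permDefect σ q u = 0 ∧ permDefect σ q v = 1 := by
  obtain ⟨a, ha⟩ : ∃ a, σ a ≠ a := by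
    by_contra! h
    exact hσ (Equiv.ext h)
  have hcard : 1 < (({a, σ a} : Finset (Fin n))ᶜ).card := by
    rw [Finset.card_compl, Fintype.card_fin]
    have := Finset.card_le_two (a := a) (b := σ a)
    omega
  obtain ⟨k, hk, l, hl, hkl⟩ := Finset.one_lt_card.1 hcard
  simp only [Finset.mem_compl, Finset.mem_insert, Finset.mem_singleton, not_or] at hk hl
  let e : Fin n → Fin n → Fin n → ℝ := fun m i j =>
    if (i = a ∧ j = m) ∨ (i = m ∧ j = a) then 1 else 0
  have he : ∀ m, m ≠ a → e m ∈ symmetricHollow n := by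
    intro m hm
    refine ⟨fun i => ?_, fun i j => ?_⟩
    · simp only [e]
      rw [if_neg]
      rintro (⟨h, h'⟩ | ⟨h, h'⟩)
      · exact hm (h'.symm.trans h)
      · exact hm (h.symm.trans h')
    · simp only [e]
      congr 1
      exact propext ⟨fun h => by tauto, fun h => by tauto⟩
  refine ⟨e k, he k hk.1, e l, he l hl.1, (a, k), (a, l), ?_, ?_, ?_⟩
  · simp [permDefect, e, ha, Ne.symm hk.2]
  · simp [permDefect, e, ha, Ne.symm hk.2, Ne.symm hkl, Ne.symm hk.1]
  · simp [permDefect, e, ha, Ne.symm hl.2]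

theorem not_symmetricHollow_le_proportionalDefect {n : ℕ} (hn : 4 ≤ n)
    {σ : Equiv.Perm (Fin n)} (hσ : σ ≠ 1) {x : Fin n → Fin n → ℝ}
    (hx : x ∈ genericMetricVectors n) : ¬ symmetricHollow n ≤ proportionalDefect σ x := by
  intro hle
  obtain ⟨u, hu, v, hv, p, q, hpu, hqu, hqv⟩ := exists_independent_permDefect hn hσ
  have hq : permDefect σ q x = 0 := by
    simpa [hpu, hqu] using mem_proportionalDefect.1 (hle hu) p q
  refine hσ ((mem_genericMetricVectors_iff.1 hx).2 σ (permDefect_eq_zero_iff.1 fun r => ?_))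
  simpa [hq, hqv] using (mem_proportionalDefect.1 (hle hv) r q).symm

theorem segment_subset_genericMetricVectors {n : ℕ} {x z : Fin n → Fin n → ℝ}
    (hx : x ∈ genericMetricVectors n) (hz : z ∈ strictMetricVectors n)
    (hxz : ∀ σ : Equiv.Perm (Fin n), σ ≠ 1 → z ∉ proportionalDefect σ x) :
    segment ℝ x z ⊆ genericMetricVectors n := by
  rw [mem_genericMetricVectors_iff] at hx
  rintro w ⟨a, b, ha, hb, hab, rfl⟩
  refine mem_genericMetricVectors_iff.2
    ⟨convex_strictMetricVectors n hx.1 hz ha hb hab, fun σ hσ => ?_⟩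
  by_contra hne
  have hdef : ∀ p, a * permDefect σ p x + b * permDefect σ p z = 0 := by
    simpa using permDefect_eq_zero_iff.2 hσ
  by_cases hb0 : b = 0
  · have ha1 : a = 1 := by linarith
    refine hne (hx.2 σ (permDefect_eq_zero_iff.1 fun p => ?_))
    simpa [hb0, ha1] using hdef p
  · refine hxz σ hne (mem_proportionalDefect.2 fun p q => mul_left_cancel₀ hb0 ?_)
    linear_combination permDefect σ q x * hdef p - permDefect σ p x * hdef q

theorem genericMetricVectors_nonempty {n : ℕ} (hn : 4 ≤ n) :
    (genericMetricVectors n).Nonempty := by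
  obtain ⟨z, hz, hzW⟩ := exists_strictMetricVector_notMem
    (fun σ : { σ : Equiv.Perm (Fin n) // σ ≠ 1 } => ⨅ p, LinearMap.ker (permDefect σ.1 p))
    (fun σ hle => by
      obtain ⟨u, hu, -, -, p, -, hpu, -⟩ := exists_independent_permDefect hn σ.2
      have := (Submodule.mem_iInf _).1 (hle hu) p
      simp [hpu] at this)
  refine ⟨z, mem_genericMetricVectors_iff.2 ⟨hz, fun σ hσ => ?_⟩⟩
  by_contra hne
  exact hzW ⟨σ, hne⟩ ((Submodule.mem_iInf _).2 (permDefect_eq_zero_iff.2 hσ))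

/-- Any two generic metric vectors are joined by two segments of generic metric vectors. -/
theorem exists_segments_subset_genericMetricVectors {n : ℕ} (hn : 4 ≤ n)
    {x y : Fin n → Fin n → ℝ} (hx : x ∈ genericMetricVectors n)
    (hy : y ∈ genericMetricVectors n) :
    ∃ z, segment ℝ x z ⊆ genericMetricVectors n ∧ segment ℝ z y ⊆ genericMetricVectors n := by
  obtain ⟨z, hz, hzW⟩ := exists_strictMetricVector_notMem
    (Sum.elim (fun σ : { σ : Equiv.Perm (Fin n) // σ ≠ 1 } => proportionalDefect σ.1 x)
      (fun σ : { σ : Equiv.Perm (Fin n) // σ ≠ 1 } => proportionalDefect σ.1 y))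
    (by
      rintro (σ | σ)
      · exact not_symmetricHollow_le_proportionalDefect hn σ.2 hx
      · exact not_symmetricHollow_le_proportionalDefect hn σ.2 hy)
  refine ⟨z, segment_subset_genericMetricVectors hx hz fun σ hσ => hzW (.inl ⟨σ, hσ⟩), ?_⟩
  rw [segment_symm]
  exact segment_subset_genericMetricVectors hy hz fun σ hσ => hzW (.inr ⟨σ, hσ⟩)

/-- For `n ≥ 4`, the set `C_n^g` of generic metric vectors is path-connected; moreover,
any two of its points can be joined by a polygonal line lying entirely in `C_n^g`. -/
theorem genericMetricVectors_pathConnected (n : ℕ) (hn : 4 ≤ n) :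
    IsPathConnected (genericMetricVectors n) ∧
    ∀ x ∈ genericMetricVectors n, ∀ y ∈ genericMetricVectors n,
      ∃ (m : ℕ) (p : Fin (m + 1) → (Fin n → Fin n → ℝ)),
        p 0 = x ∧ p (Fin.last m) = y ∧
        ∀ i : Fin m, segment ℝ (p i.castSucc) (p i.succ) ⊆ genericMetricVectors n := by
  refine ⟨isPathConnected_iff.2 ⟨genericMetricVectors_nonempty hn, fun x hx y hy => ?_⟩,
    fun x hx y hy => ?_⟩
  · obtain ⟨z, hxz, hzy⟩ := exists_segments_subset_genericMetricVectors hn hx hy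
    exact (JoinedIn.of_segment_subset hxz).trans (JoinedIn.of_segment_subset hzy)
  · obtain ⟨z, hxz, hzy⟩ := exists_segments_subset_genericMetricVectors hn hx hy
    refine ⟨2, ![x, z, y], rfl, rfl, fun i => ?_⟩
    fin_cases i
    · exact hxz
    · exact hzy
end

section
/- For n = 3, the set C_3^g of generic metric vectors on 3 points is not path-connected: there is no continuous path inside C_3^g joining the metric vector with off-diagonal distances (d 0 1, d 0 2, d 1 2) = (3, 4, 5) to the one with (d 0 1, d 0 2, d 1 2) = (4, 3, 5). -/
/-- A permutation preserving a symmetric function on three points whose off-diagonal values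
are pairwise distinct is the identity. -/
theorem perm_fin_three_eq_one_of_preserves {d : Fin 3 → Fin 3 → ℝ}
    (hsymm : ∀ i j, d i j = d j i) (h₁ : d 0 1 ≠ d 0 2) (h₂ : d 0 1 ≠ d 1 2)
    (h₃ : d 0 2 ≠ d 1 2) (σ : Equiv.Perm (Fin 3))
    (hσ : ∀ i j, d (σ i) (σ j) = d i j) : σ = 1 := by
  have a := hσ 0 1
  have b := hσ 0 2
  have c := hσ 1 2
  have i₁ : σ 0 ≠ σ 1 := σ.injective.ne (by decide)
  have i₂ : σ 0 ≠ σ 2 := σ.injective.ne (by decide)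
  have i₃ : σ 1 ≠ σ 2 := σ.injective.ne (by decide)
  have s₁ := hsymm 0 1
  have s₂ := hsymm 0 2
  have s₃ := hsymm 1 2
  have key : σ 0 = 0 ∧ σ 1 = 1 ∧ σ 2 = 2 := by
    clear hσ hsymm
    generalize σ 0 = x at *
    generalize σ 1 = y at *
    generalize σ 2 = z at *
    fin_cases x <;> fin_cases y <;> fin_cases z <;>
      simp at a b c i₁ i₂ i₃ ⊢ <;> grind
  ext i
  fin_cases i <;> simp [key]

/-- Three distinct positive reals satisfying the strict triangle inequalities are the
distances of a generic metric vector on three points. -/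
theorem mem_genericMetricVectors_three {a b c : ℝ} (ha : 0 < a) (hb : 0 < b) (hc : 0 < c)
    (hab : a ≠ b) (hac : a ≠ c) (hbc : b ≠ c)
    (habc : a < b + c) (hbac : b < a + c) (hcab : c < a + b) :
    (![![(0 : ℝ), a, b], ![a, 0, c], ![b, c, 0]]) ∈ genericMetricVectors 3 := by
  have hsymm : ∀ i j, (![![(0 : ℝ), a, b], ![a, 0, c], ![b, c, 0]]) i j =
      (![![(0 : ℝ), a, b], ![a, 0, c], ![b, c, 0]]) j i := by
    intro i j
    fin_cases i <;> fin_cases j <;> simp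
  refine ⟨⟨?_, hsymm, ?_, ?_⟩, ?_,
    perm_fin_three_eq_one_of_preserves hsymm (by simpa) (by simpa) (by simpa)⟩
  · intro i
    fin_cases i <;> simp
  · intro i j hij
    fin_cases i <;> fin_cases j <;> simp_all
  · intro i j k
    fin_cases i <;> fin_cases j <;> fin_cases k <;> simp <;> linarith
  · intro i j k hij hjk hik
    fin_cases i <;> fin_cases j <;> fin_cases k <;> simp at hij hjk hik ⊢ <;> linarith

/-- In a generic metric vector on three points, the two distances from the point `0` differ. -/
theorem dist_zero_one_ne_dist_zero_two {d : Fin 3 → Fin 3 → ℝ}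
    (hd : d ∈ genericMetricVectors 3) : d 0 1 ≠ d 0 2 := by
  obtain ⟨⟨hdiag, hsymm, -, -⟩, -, hreg⟩ := hd
  intro h
  have hswap : Equiv.swap (1 : Fin 3) 2 = 1 := by
    refine hreg _ fun i j => ?_
    have e₀ : Equiv.swap (1 : Fin 3) 2 0 = 0 := by decide
    have e₁ : Equiv.swap (1 : Fin 3) 2 1 = 2 := by decide
    have e₂ : Equiv.swap (1 : Fin 3) 2 2 = 1 := by decide
    have s₁ := hsymm 1 0
    have s₂ := hsymm 2 0
    have s₃ := hsymm 2 1
    fin_cases i <;> fin_cases j <;> simp [e₀, e₁, e₂, hdiag, s₁, s₂, s₃, h]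
  exact absurd hswap (by decide)

/-- `C_3^g` is not path-connected: the generic metric vectors with off-diagonal distances
`(3, 4, 5)` and `(4, 3, 5)` both lie in `C_3^g`, but cannot be joined by a continuous path
inside `C_3^g`. -/
theorem genericMetricVectors_three_not_pathConnected :
    (![![(0 : ℝ), 3, 4], ![3, 0, 5], ![4, 5, 0]]) ∈ genericMetricVectors 3 ∧
    (![![(0 : ℝ), 4, 3], ![4, 0, 5], ![3, 5, 0]]) ∈ genericMetricVectors 3 ∧
    ¬ JoinedIn (genericMetricVectors 3)
        (![![(0 : ℝ), 3, 4], ![3, 0, 5], ![4, 5, 0]])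
        (![![(0 : ℝ), 4, 3], ![4, 0, 5], ![3, 5, 0]]) := by
  refine ⟨?_, ?_, ?_⟩
  · apply mem_genericMetricVectors_three <;> norm_num
  · apply mem_genericMetricVectors_three <;> norm_num
  · rintro ⟨γ, hγ⟩
    have hcont : Continuous fun t => γ t 0 1 - γ t 0 2 := by fun_prop
    obtain ⟨t, ht⟩ := mem_range_of_exists_le_of_exists_ge hcont (c := 0)
      ⟨0, by simp; norm_num⟩ ⟨1, by simp; norm_num⟩
    exact dist_zero_one_ne_dist_zero_two (hγ t) (sub_eq_zero.mp ht)
end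

section
/- Let d be a positive integer and let h be a surjective isometry of the space ℝ^d equipped with the supremum norm onto itself. Then there exist a vector b ∈ ℝ^d, a permutation σ of {1, …, d}, and signs ε_i ∈ {+1, −1} such that h(x)_i = ε_i · x_{σ(i)} + b_i for all x ∈ ℝ^d and all i. In particular, every linear isometry of (ℝ^d, ‖·‖_∞) onto itself is a signed permutation of the coordinates. -/
namespace LinearIsometry

variable {ι : Type*} [Fintype ι] [DecidableEq ι]

lemma pi_apply_eq_sum (L : (ι → ℝ) →ₗᵢ[ℝ] (ι → ℝ)) (x : ι → ℝ) (i : ι) :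
    L x i = ∑ j, x j * L (Pi.single j 1) i := by
  conv_lhs => rw [pi_eq_sum_univ' x]
  simp

lemma sum_abs_pi_apply_single_le_one (L : (ι → ℝ) →ₗᵢ[ℝ] (ι → ℝ)) (i : ι) :
    ∑ j, |L (Pi.single j 1) i| ≤ 1 := by
  set c : ι → ℝ := fun j => (SignType.sign (L (Pi.single j 1) i) : ℝ)
  have hc : ‖c‖ ≤ 1 := by
    refine (pi_norm_le_iff_of_nonneg zero_le_one).2 fun j => ?_
    simp only [c]
    cases SignType.sign (L (Pi.single j 1) i) <;> simp
  calc ∑ j, |L (Pi.single j 1) i| = L c i := by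
        simp only [L.pi_apply_eq_sum c, c, sign_mul_self]
    _ ≤ ‖L c i‖ := le_abs_self _
    _ ≤ ‖L c‖ := norm_le_pi_norm _ i
    _ ≤ 1 := (L.norm_map c).trans_le hc

lemma exists_one_le_abs_pi_apply_single (L : (ι → ℝ) →ₗᵢ[ℝ] (ι → ℝ)) (j : ι) :
    ∃ i, 1 ≤ |L (Pi.single j 1) i| := by
  by_contra! H
  have h1 : ‖L (Pi.single j 1)‖ < 1 := (pi_norm_lt_iff zero_lt_one).2 H
  simp [L.norm_map, Pi.norm_single] at h1

/-- Linear isometries of `ι → ℝ` with the sup norm are signed permutations of the coordinates. -/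
theorem exists_perm_sign_pi_apply (L : (ι → ℝ) →ₗᵢ[ℝ] (ι → ℝ)) :
    ∃ (σ : Equiv.Perm ι) (ε : ι → ℝ),
      (∀ i, ε i = 1 ∨ ε i = -1) ∧ ∀ x i, L x i = ε i * x (σ i) := by
  choose τ hτ using L.exists_one_le_abs_pi_apply_single
  have hsum (j : ι) : |L (Pi.single j 1) (τ j)| +
      ∑ k ∈ Finset.univ.erase j, |L (Pi.single k 1) (τ j)| ≤ 1 :=
    (Finset.add_sum_erase _ (fun k => |L (Pi.single k 1) (τ j)|) (Finset.mem_univ j)).trans_le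
      (L.sum_abs_pi_apply_single_le_one (τ j))
  have hzero (j k : ι) (hkj : k ≠ j) : L (Pi.single k 1) (τ j) = 0 := by
    have hle := Finset.single_le_sum (s := Finset.univ.erase j)
      (f := fun k => |L (Pi.single k 1) (τ j)|) (fun _ _ => abs_nonneg _)
      (Finset.mem_erase.2 ⟨hkj, Finset.mem_univ k⟩)
    exact abs_nonpos_iff.1 (by linarith [hτ j, hsum j])
  have hone (j : ι) : |L (Pi.single j 1) (τ j)| = 1 := by
    have hnn := Finset.sum_nonneg (s := Finset.univ.erase j)
      (f := fun k => |L (Pi.single k 1) (τ j)|) (fun _ _ => abs_nonneg _)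
    linarith [hτ j, hsum j]
  have hinj : Function.Injective τ := by
    intro j k hjk
    by_contra hne
    have h1 := hone j
    rw [hjk, hzero k j hne] at h1
    simp at h1
  let e : Equiv.Perm ι := Equiv.ofBijective τ (Finite.injective_iff_bijective.1 hinj)
  refine ⟨e.symm, fun i => L (Pi.single (e.symm i) 1) i, fun i => ?_, fun x i => ?_⟩
  · obtain ⟨j, rfl⟩ := e.surjective i
    simp only [e.symm_apply_apply]
    exact eq_or_eq_neg_of_abs_eq (hone j)
  · obtain ⟨j, rfl⟩ := e.surjective i
    simp only [e.symm_apply_apply]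
    rw [L.pi_apply_eq_sum, mul_comm]
    exact Fintype.sum_eq_single j fun k hkj => mul_eq_zero_of_right _ (hzero j k hkj)

end LinearIsometry


/-- **Isometries of `ℝ^d` with the sup norm.** Every surjective isometry of
`ℝ^d = (Fin d → ℝ)` with the supremum distance onto itself has the form
`h(x)_i = ε_i · x_{σ(i)} + b_i` for a translation vector `b`, a permutation `σ` of the
coordinates, and signs `ε_i ∈ {1, -1}`. (The sup distance is the standard product metric
on `Fin d → ℝ` in Mathlib.) -/
theorem isometryEquiv_pi_sup_norm (d : ℕ) (hd : 0 < d)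
    (h : (Fin d → ℝ) ≃ᵢ (Fin d → ℝ)) :
    ∃ (b : Fin d → ℝ) (σ : Equiv.Perm (Fin d)) (ε : Fin d → ℝ),
      (∀ i, ε i = 1 ∨ ε i = -1) ∧ ∀ (x : Fin d → ℝ) (i : Fin d),
        h x i = ε i * x (σ i) + b i := by
  obtain ⟨σ, ε, hε, hL⟩ :=
    h.toRealLinearIsometryEquiv.toLinearIsometry.exists_perm_sign_pi_apply
  refine ⟨h 0, σ, ε, hε, fun x i => ?_⟩
  rw [← hL x i]
  simp [IsometryEquiv.toRealLinearIsometryEquiv_apply]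
end

section
/- Let n ≥ 5 and let α be a permutation of the edge set E(K_n) of the complete graph on n vertices. Then α is induced by a permutation of the vertices (i.e., there is a permutation σ of Fin n with α({i,j}) = {σ(i), σ(j)} for all edges {i,j}) if and only if α maps every pair of adjacent edges to a pair of adjacent edges. -/
/-- Two edges of the complete graph `K_n` (unordered pairs of distinct elements of
`Fin n`) are adjacent if they are distinct and share a vertex. -/
def EdgeAdj {n : ℕ} (e f : {e : Sym2 (Fin n) // ¬ e.IsDiag}) : Prop :=
  e ≠ f ∧ ∃ v : Fin n, v ∈ e.val ∧ v ∈ f.val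

/-- If a fourth edge meets each of three pairwise meeting edges, the three do not form a
triangle: they contain the common vertex of any two of them. -/
theorem Sym2.mem_of_pairwise_meet {V : Type*} {p q r t : Sym2 V} {w : V}
    (hpq : p ≠ q) (hpt : p ≠ t) (hqt : q ≠ t) (hrt : r ≠ t) (hwp : w ∈ p) (hwq : w ∈ q)
    (pr : ∃ v, v ∈ p ∧ v ∈ r) (qr : ∃ v, v ∈ q ∧ v ∈ r) (pt : ∃ v, v ∈ p ∧ v ∈ t)
    (qt : ∃ v, v ∈ q ∧ v ∈ t) (rt : ∃ v, v ∈ r ∧ v ∈ t) : w ∈ r := by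
  obtain ⟨a, rfl⟩ := Sym2.mem_iff_exists.1 hwp
  obtain ⟨b, rfl⟩ := Sym2.mem_iff_exists.1 hwq
  have hab : a ≠ b := fun h => hpq (by rw [h])
  by_contra hwr
  have har : a ∈ r := by
    obtain ⟨v, hv, hvr⟩ := pr
    grind
  have hbr : b ∈ r := by
    obtain ⟨v, hv, hvr⟩ := qr
    grind
  have hr : r = s(a, b) := (Sym2.mem_and_mem_iff hab).1 ⟨har, hbr⟩
  by_cases hwt : w ∈ t
  · obtain ⟨c, rfl⟩ := Sym2.mem_iff_exists.1 hwt
    obtain ⟨v, hv, hvt⟩ := rt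
    grind
  · have hat : a ∈ t := by
      obtain ⟨v, hv, hvt⟩ := pt
      grind
    have hbt : b ∈ t := by
      obtain ⟨v, hv, hvt⟩ := qt
      grind
    exact hrt (hr.trans ((Sym2.mem_and_mem_iff hab).1 ⟨hat, hbt⟩).symm)

/-- An edge permutation preserving adjacency maps the star of each vertex into a star. -/
theorem exists_star_image {n : ℕ} (hn : 5 ≤ n)
    (α : Equiv.Perm {e : Sym2 (Fin n) // ¬ e.IsDiag})
    (hα : ∀ e f, EdgeAdj e f → EdgeAdj (α e) (α f)) (v : Fin n) :
    ∃ w, ∀ e : {e : Sym2 (Fin n) // ¬ e.IsDiag}, v ∈ e.val → w ∈ (α e).val := by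
  have fresh (s : Finset (Fin n)) (hs : s.card < 5) : ∃ x, x ∉ s := by
    by_contra! h
    have := Finset.card_le_card (fun x _ => h x : Finset.univ ⊆ s)
    simp only [Finset.card_univ, Fintype.card_fin] at this
    omega
  have edge (x : Fin n) (hx : x ≠ v) :
      ∃ e : {e : Sym2 (Fin n) // ¬ e.IsDiag}, e.val = s(v, x) :=
    ⟨⟨s(v, x), by simpa using hx.symm⟩, rfl⟩
  have adj (e f : {e : Sym2 (Fin n) // ¬ e.IsDiag}) (he : v ∈ e.val) (hf : v ∈ f.val)
      (hef : e ≠ f) : (α e).val ≠ (α f).val ∧ ∃ u, u ∈ (α e).val ∧ u ∈ (α f).val := by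
    obtain ⟨hne, hu⟩ := hα e f ⟨hef, v, he, hf⟩
    exact ⟨fun h => hne (Subtype.ext h), hu⟩
  obtain ⟨a, ha⟩ := fresh {v} (by simp)
  obtain ⟨b, hb⟩ := fresh {v, a} (Finset.card_le_two.trans_lt (by norm_num))
  simp only [Finset.mem_insert, Finset.mem_singleton, not_or] at ha hb
  obtain ⟨p, hp⟩ := edge a ha
  obtain ⟨q, hq⟩ := edge b hb.1
  have hvp : v ∈ p.val := by simp [hp]
  have hvq : v ∈ q.val := by simp [hq]
  have hpq : p ≠ q := by
    rintro rfl
    exact hb.2 (Sym2.congr_right.1 (hq.symm.trans hp))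
  obtain ⟨hne, w, hwp, hwq⟩ := adj p q hvp hvq hpq
  refine ⟨w, fun r hvr => ?_⟩
  by_cases hpr : p = r
  · rwa [← hpr]
  by_cases hqr : q = r
  · rwa [← hqr]
  obtain ⟨c, hc⟩ := Sym2.mem_iff_exists.1 hvr
  obtain ⟨d, hd⟩ := fresh {v, a, b, c} (Finset.card_le_four.trans_lt (by norm_num))
  simp only [Finset.mem_insert, Finset.mem_singleton, not_or] at hd
  obtain ⟨t, ht⟩ := edge d hd.1
  have hvt : v ∈ t.val := by simp [ht]
  have ne_t (e : {e : Sym2 (Fin n) // ¬ e.IsDiag}) (x : Fin n) (he : e.val = s(v, x))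
      (hx : d ≠ x) : e ≠ t := by
    rintro rfl
    exact hx (Sym2.congr_right.1 (ht.symm.trans he))
  have hpt := adj p t hvp hvt (ne_t p a hp hd.2.1)
  have hqt := adj q t hvq hvt (ne_t q b hq hd.2.2.1)
  have hrt := adj r t hvr hvt (ne_t r c hc hd.2.2.2)
  exact Sym2.mem_of_pairwise_meet hne hpt.1 hqt.1 hrt.1 hwp hwq
    (adj p r hvp hvr hpr).2 (adj q r hvq hvr hqr).2 hpt.2 hqt.2 hrt.2

/-- If an edge permutation maps the star of `u` into the star of `w`, then every edge at `w` is
the image of an edge at `u`. -/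
theorem mem_of_mem_image_of_star_image {n : ℕ} (α : Equiv.Perm {e : Sym2 (Fin n) // ¬ e.IsDiag})
    {u w : Fin n} (h : ∀ e : {e : Sym2 (Fin n) // ¬ e.IsDiag}, u ∈ e.val → w ∈ (α e).val)
    (e : {e : Sym2 (Fin n) // ¬ e.IsDiag}) (he : w ∈ (α e).val) : u ∈ e.val := by
  have key (x : Fin n) : ∃ y, (x = u ∧ y = w) ∨
      ∃ hx : u ≠ x, (α ⟨s(u, x), by simpa using hx⟩).val = s(w, y) := by
    by_cases hx : u = x
    · exact ⟨w, .inl ⟨hx.symm, rfl⟩⟩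
    · obtain ⟨y, hy⟩ := Sym2.mem_iff_exists.1
        (h ⟨s(u, x), by simpa using hx⟩ (Sym2.mem_mk_left u x))
      exact ⟨y, .inr ⟨hx, hy⟩⟩
  choose g hg using key
  have ne_w (x : Fin n) (hx : u ≠ x)
      (hgx : (α ⟨s(u, x), by simpa using hx⟩).val = s(w, g x)) : g x ≠ w := by
    intro hw
    apply (α ⟨s(u, x), by simpa using hx⟩).property
    rw [hgx, hw]
    simp
  have hinj : Function.Injective g := by
    intro x y hxy
    rcases hg x with ⟨rfl, hx⟩ | ⟨hux, hx⟩ <;> rcases hg y with ⟨hyu, hy⟩ | ⟨huy, hy⟩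
    · exact hyu.symm
    · exact absurd (hxy.symm.trans hx) (ne_w y huy hy)
    · exact absurd (hxy.trans hy) (ne_w x hux hx)
    · have := α.injective (Subtype.ext (hx.trans ((congrArg (s(w, ·)) hxy).trans hy.symm)))
      exact Sym2.congr_right.1 (congrArg Subtype.val this)
  obtain ⟨z, hz⟩ := Sym2.mem_iff_exists.1 he
  obtain ⟨x, rfl⟩ := Finite.surjective_of_injective hinj z
  rcases hg x with ⟨-, hx⟩ | ⟨hux, hx⟩
  · exact absurd (by simp [hz, hx]) (α e).property
  · rw [α.injective (Subtype.ext (hz.trans hx.symm))]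
    exact Sym2.mem_mk_left u x

/-- For `n ≥ 5`, a permutation of the edge set of the complete graph `K_n` is induced by a
permutation of the vertices if and only if it takes every pair of adjacent edges to a pair
of adjacent edges. -/
theorem edge_perm_induced_iff_preserves_adjacency (n : ℕ) (hn : 5 ≤ n)
    (α : Equiv.Perm {e : Sym2 (Fin n) // ¬ e.IsDiag}) :
    (∃ σ : Equiv.Perm (Fin n),
      ∀ e : {e : Sym2 (Fin n) // ¬ e.IsDiag}, (α e).val = Sym2.map σ e.val) ↔
    (∀ e f : {e : Sym2 (Fin n) // ¬ e.IsDiag}, EdgeAdj e f → EdgeAdj (α e) (α f)) := by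
  constructor
  · rintro ⟨σ, hσ⟩ e f ⟨hef, v, hve, hvf⟩
    refine ⟨α.injective.ne hef, σ v, ?_, ?_⟩
    · rw [hσ]
      exact Sym2.mem_map.2 ⟨v, hve, rfl⟩
    · rw [hσ]
      exact Sym2.mem_map.2 ⟨v, hvf, rfl⟩
  · intro hα
    choose f hf using exists_star_image hn α hα
    have hinj : Function.Injective f := by
      intro u v huv
      by_contra hne
      obtain ⟨x, hx⟩ : ∃ x, x ∉ ({u, v} : Finset (Fin n)) := by
        by_contra! h
        have := Finset.card_le_card (fun x _ => h x : Finset.univ ⊆ {u, v})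
        have := this.trans Finset.card_le_two
        simp only [Finset.card_univ, Fintype.card_fin] at this
        omega
      simp only [Finset.mem_insert, Finset.mem_singleton, not_or] at hx
      have hu := mem_of_mem_image_of_star_image α (hf u)
        ⟨s(v, x), by simpa using Ne.symm hx.2⟩ (huv ▸ hf v _ (Sym2.mem_mk_left v x))
      rcases Sym2.mem_iff.1 hu with h | h
      · exact hne h
      · exact hx.1 h.symm
    refine ⟨Equiv.ofBijective f (Finite.injective_iff_bijective.1 hinj), ?_⟩
    rintro ⟨e, he⟩
    induction e using Sym2.ind with
    | _ i j =>
      have hij : i ≠ j := by simpa using he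
      exact (Sym2.mem_and_mem_iff (hinj.ne hij)).1
        ⟨hf i _ (Sym2.mem_mk_left i j), hf j _ (Sym2.mem_mk_right i j)⟩
end

section
/- Let n ≥ 8 and let P be any permutation of the edge set E(K_n) of the complete graph on n vertices. Then there exist two non-adjacent (vertex-disjoint) edges e₁ ≠ e₂ of K_n such that P(e₁) and P(e₂) are also non-adjacent. (This follows since the number of unordered pairs of non-adjacent edges, n(n−1)(n−2)(n−3)/8, exceeds the number of unordered pairs of adjacent edges, n(n−1)(n−2)/2, when n ≥ 8.) -/
/-- The non-diagonal pairs meeting `{a, b}` number at most `2 (n - 1)`. -/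
theorem card_nondiag_mem_or_mem_le {n : ℕ} (a b : Fin n) :
    (Finset.univ.filter fun e : Sym2 (Fin n) => ¬ e.IsDiag ∧ (a ∈ e ∨ b ∈ e)).card
      ≤ 2 * (n - 1) := by
  have h_image (c : Fin n) :
      ((Finset.univ.erase c).image fun x => s(c, x)).card ≤ n - 1 := by
    simpa using Finset.card_image_le (s := Finset.univ.erase c) (f := fun x => s(c, x))
  have h_mem (c : Fin n) (e : Sym2 (Fin n)) (he : ¬ e.IsDiag) (hc : c ∈ e) :
      e ∈ (Finset.univ.erase c).image fun x => s(c, x) := by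
    obtain ⟨x, rfl⟩ := hc
    refine Finset.mem_image_of_mem _ (Finset.mem_erase.2 ⟨?_, Finset.mem_univ x⟩)
    rintro rfl
    exact he rfl
  calc _ ≤ (((Finset.univ.erase a).image fun x => s(a, x)) ∪
            ((Finset.univ.erase b).image fun x => s(b, x))).card := by
        refine Finset.card_le_card fun e he => ?_
        obtain ⟨hd, h | h⟩ := (Finset.mem_filter.1 he).2
        · exact Finset.mem_union_left _ (h_mem a e hd h)
        · exact Finset.mem_union_right _ (h_mem b e hd h)
    _ ≤ _ := Finset.card_union_le _ _
    _ ≤ _ := by linarith [h_image a, h_image b]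

/-- For `n ≥ 8`, the pairs of distinct vertices avoiding two given vertices outnumber
`2 (n - 1)`. -/
theorem two_mul_pred_lt_choose_two {n : ℕ} (hn : 8 ≤ n) : 2 * (n - 1) < (n - 2).choose 2 := by
  obtain ⟨m, rfl⟩ := Nat.exists_eq_add_of_le' hn
  rw [Nat.choose_two_right, show m + 8 - 2 = m + 6 by omega, show m + 8 - 1 = m + 7 by omega,
    show m + 6 - 1 = m + 5 by omega, Nat.lt_iff_add_one_le, Nat.le_div_iff_mul_le two_pos]
  nlinarith

/-- For `n ≥ 8`, every permutation of the edge set of the complete graph `K_n` takes some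
pair of non-adjacent (vertex-disjoint) edges to a pair of non-adjacent edges. -/
theorem edge_perm_maps_disjoint_pair_to_disjoint (n : ℕ) (hn : 8 ≤ n)
    (P : Equiv.Perm {e : Sym2 (Fin n) // ¬ e.IsDiag}) :
    ∃ e₁ e₂ : {e : Sym2 (Fin n) // ¬ e.IsDiag},
      e₁ ≠ e₂ ∧ (∀ v : Fin n, v ∈ e₁.val → v ∉ e₂.val) ∧
      (∀ v : Fin n, v ∈ (P e₁).val → v ∉ (P e₂).val) := by
  obtain ⟨u, v, huv⟩ : ∃ u v : Fin n, u ≠ v :=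
    ⟨⟨0, by omega⟩, ⟨1, by omega⟩, by simp⟩
  let e₁ : {e : Sym2 (Fin n) // ¬ e.IsDiag} := ⟨s(u, v), by simpa using huv⟩
  obtain ⟨a, b, hab⟩ : ∃ a b, (P e₁).val = s(a, b) := by
    induction h : (P e₁).val with | _ a b => exact ⟨a, b, rfl⟩
  by_contra! hP
  let s : Finset (Fin n) := {u, v}ᶜ
  have hs : s.card = n - 2 := by
    rw [Finset.card_compl, Finset.card_pair huv, Fintype.card_fin]
  have h_mem {e : Sym2 (Fin n)} (he : e ∈ s.offDiag.image Sym2.mk.uncurry) :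
      ¬ e.IsDiag ∧ u ∉ e ∧ v ∉ e := by
    obtain ⟨⟨x, y⟩, hxy, rfl⟩ := Finset.mem_image.1 he
    simp [s] at hxy ⊢
    grind
  let f : Sym2 (Fin n) → Sym2 (Fin n) := fun e =>
    if h : ¬ e.IsDiag then (P ⟨e, h⟩).val else e
  have h_le : (s.offDiag.image Sym2.mk.uncurry).card ≤
      (Finset.univ.filter fun e : Sym2 (Fin n) => ¬ e.IsDiag ∧ (a ∈ e ∨ b ∈ e)).card := by
    refine Finset.card_le_card_of_injOn f (fun e he => ?_) (fun e he e' he' hee' => ?_)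
    · obtain ⟨hd, hu, hv⟩ := h_mem he
      obtain ⟨w, hw, hw'⟩ := hP e₁ ⟨e, hd⟩
        (fun h => hu ((show s(u, v) = e from congrArg Subtype.val h) ▸ Sym2.mem_mk_left u v))
        (fun w hw => by
          rcases Sym2.mem_iff.1 hw with rfl | rfl
          exacts [hu, hv])
      rw [hab, Sym2.mem_iff] at hw
      have hf : f e = (P ⟨e, hd⟩).val := dif_pos hd
      rw [hf]
      refine Finset.mem_filter.2 ⟨Finset.mem_univ _, (P ⟨e, hd⟩).2, ?_⟩
      rcases hw with rfl | rfl
      exacts [Or.inl hw', Or.inr hw']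
    · have hd := (h_mem he).1
      have hd' := (h_mem he').1
      simp only [f, dif_pos hd, dif_pos hd'] at hee'
      exact congrArg Subtype.val (P.injective (Subtype.ext hee'))
  have h_card : (s.offDiag.image Sym2.mk.uncurry).card = (n - 2).choose 2 := by
    rw [← hs]
    exact Sym2.card_image_offDiag s
  exact absurd (h_card ▸ h_le.trans (card_nondiag_mem_or_mem_le a b))
    (two_mul_pred_lt_choose_two hn).not_ge
end

section
/- Let n ≥ 8 and let G ≤ Perm(E(K_n)) be the subgroup of all permutations of the edge set of the complete graph K_n that are induced by permutations of the vertex set Fin n. Then the normalizer of G in the full permutation group of E(K_n) equals G: if P is a permutation of E(K_n) with P⁻¹ g P ∈ G for all g ∈ G, then P ∈ G. -/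
/-- The edge permutation of the complete graph induced by a vertex permutation. -/
def edgePermOfVertexPerm {α : Type*} (σ : Equiv.Perm α) :
    Equiv.Perm {e : Sym2 α // ¬ e.IsDiag} where
  toFun e := ⟨Sym2.map σ e.val, (Sym2.isDiag_map σ.injective).not.2 e.2⟩
  invFun e := ⟨Sym2.map σ.symm e.val, (Sym2.isDiag_map σ.symm.injective).not.2 e.2⟩
  left_inv e := Subtype.ext (by simp [Sym2.map_map])
  right_inv e := Subtype.ext (by simp [Sym2.map_map])

theorem edgePermOfVertexPerm_val {α : Type*} (σ : Equiv.Perm α)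
    (e : {e : Sym2 α // ¬ e.IsDiag}) :
    (edgePermOfVertexPerm σ e).val = Sym2.map σ e.val := rfl

/-- At least four pairwise intersecting edges have a common vertex. -/
theorem exists_common_vertex_of_four_le_card {α : Type*} (S : Finset (Sym2 α))
    (hS : ∀ e ∈ S, ∀ f ∈ S, e ≠ f → ∃ x, x ∈ e ∧ x ∈ f) (hcard : 4 ≤ S.card) :
    ∃ p, ∀ e ∈ S, p ∈ e := by
  classical
  obtain ⟨a, ha, b, hb, hab⟩ := Finset.one_lt_card.1 (by omega : 1 < S.card)
  obtain ⟨p, hpa, hpb⟩ := hS a ha b hb hab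
  obtain ⟨q, rfl⟩ := hpa
  obtain ⟨r, rfl⟩ := hpb
  have hqr : q ≠ r := by rintro rfl; exact hab rfl
  have key : ∀ c ∈ S, p ∉ c → c = s(q, r) := by
    intro c hc hpc
    obtain ⟨x, hx, hxc⟩ := hS _ ha c hc (by rintro rfl; simp at hpc)
    obtain ⟨y, hy, hyc⟩ := hS _ hb c hc (by rintro rfl; simp at hpc)
    have hxq : x = q := by
      rcases Sym2.mem_iff.1 hx with rfl | h
      · exact absurd hxc hpc
      · exact h
    have hyr : y = r := by
      rcases Sym2.mem_iff.1 hy with rfl | h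
      · exact absurd hyc hpc
      · exact h
    subst hxq hyr
    exact (Sym2.mem_and_mem_iff hqr).1 ⟨hxc, hyc⟩
  by_contra! hcon
  obtain ⟨c, hc, hpc⟩ := hcon p
  obtain rfl := key c hc hpc
  have hsub : S ⊆ {s(p, q), s(p, r), s(q, r)} := by
    intro d hd
    by_cases hpd : p ∈ d
    · obtain ⟨x, hxd, hx⟩ := hS d hd _ hc (by rintro rfl; exact hpc hpd)
      have hpx : p ≠ x := by rintro rfl; exact hpc hx
      have := (Sym2.mem_and_mem_iff hpx).1 ⟨hpd, hxd⟩
      rcases Sym2.mem_iff.1 hx with rfl | rfl <;> simp [this]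
    · simp [key d hd hpd]
  have := (Finset.card_le_card hsub).trans Finset.card_le_three
  omega

/-- The edges of the complete graph on `Fin n` that contain a given vertex. -/
def edgeStar {n : ℕ} (v : Fin n) : Finset {e : Sym2 (Fin n) // ¬ e.IsDiag} :=
  Finset.univ.filter fun e => v ∈ e.val

theorem mem_edgeStar {n : ℕ} {v : Fin n} {e : {e : Sym2 (Fin n) // ¬ e.IsDiag}} :
    e ∈ edgeStar v ↔ v ∈ e.val := by
  simp [edgeStar]

theorem card_edgeStar {n : ℕ} (v : Fin n) : (edgeStar v).card = n - 1 := by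
  have h : (edgeStar v).map (Function.Embedding.subtype _) =
      (⊤ : SimpleGraph (Fin n)).incidenceFinset v := by
    ext e
    simp [mem_edgeStar, SimpleGraph.incidenceSet, and_comm]
  rw [← Finset.card_map (Function.Embedding.subtype _), h,
    SimpleGraph.card_incidenceFinset_eq_degree, SimpleGraph.complete_graph_degree,
    Fintype.card_fin]

/-- The symmetric group is transitive on ordered pairs of distinct intersecting edges. -/
theorem exists_perm_map_intersecting_pair {α : Type*} {e f e' f' : Sym2 α}
    (he : ¬ e.IsDiag) (hf : ¬ f.IsDiag) (hef : e ≠ f) (h : ∃ x, x ∈ e ∧ x ∈ f)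
    (he' : ¬ e'.IsDiag) (hf' : ¬ f'.IsDiag) (hef' : e' ≠ f') (h' : ∃ x, x ∈ e' ∧ x ∈ f') :
    ∃ σ : Equiv.Perm α, Sym2.map σ e = e' ∧ Sym2.map σ f = f' := by
  obtain ⟨p, ⟨q, rfl⟩, ⟨r, rfl⟩⟩ := h
  obtain ⟨p', ⟨q', rfl⟩, ⟨r', rfl⟩⟩ := h'
  have inj : ∀ {p q r : α}, p ≠ q → p ≠ r → q ≠ r → Function.Injective ![p, q, r] := by
    intro p q r h1 h2 h3 i j hij
    fin_cases i <;> fin_cases j <;> simp_all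
  have hqr : q ≠ r := by rintro rfl; exact hef rfl
  have hqr' : q' ≠ r' := by rintro rfl; exact hef' rfl
  have := Equiv.Perm.isMultiplyPretransitive α 3
  obtain ⟨σ, hσ⟩ := MulAction.exists_smul_eq (Equiv.Perm α)
    (⟨_, inj he hf hqr⟩ : Fin 3 ↪ α) ⟨_, inj he' hf' hqr'⟩
  have h0 := DFunLike.congr_fun hσ 0
  have h1 := DFunLike.congr_fun hσ 1
  have h2 := DFunLike.congr_fun hσ 2
  simp [Function.Embedding.smul_apply] at h0 h1 h2
  exact ⟨σ, by simp [h0, h1], by simp [h0, h2]⟩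

/-- No permutation of the edges makes all pairs of distinct intersecting edges disjoint. -/
theorem exists_intersecting_pair_image_intersecting {n : ℕ} (hn : 3 ≤ n)
    (Q : Equiv.Perm {e : Sym2 (Fin n) // ¬ e.IsDiag}) :
    ∃ e f, e ≠ f ∧ (∃ x, x ∈ e.val ∧ x ∈ f.val) ∧ ∃ x, x ∈ (Q e).val ∧ x ∈ (Q f).val := by
  by_contra! hcon
  let v : Fin n := ⟨0, by omega⟩
  have hdisj : Set.PairwiseDisjoint (edgeStar v : Set {e : Sym2 (Fin n) // ¬ e.IsDiag})
      fun e => (Q e).val.toFinset := by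
    intro e he f hf hef
    refine Finset.disjoint_left.2 fun x hx hx' => ?_
    rw [Sym2.mem_toFinset] at hx hx'
    exact hcon e f hef ⟨v, mem_edgeStar.1 he, mem_edgeStar.1 hf⟩ x hx hx'
  have h1 := Finset.card_biUnion hdisj
  rw [Finset.sum_congr rfl fun e _ => Sym2.card_toFinset_of_not_isDiag _ (Q e).2,
    Finset.sum_const, card_edgeStar, smul_eq_mul] at h1
  have h2 := Finset.card_le_univ ((edgeStar v).biUnion fun e => (Q e).val.toFinset)
  rw [Fintype.card_fin] at h2
  omega

/-- An edge permutation preserving intersection is induced by a vertex permutation. -/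
theorem exists_vertexPerm_of_preserves_intersecting {n : ℕ} (hn : 5 ≤ n)
    (Q : Equiv.Perm {e : Sym2 (Fin n) // ¬ e.IsDiag})
    (hQ : ∀ e f, e ≠ f → (∃ x, x ∈ e.val ∧ x ∈ f.val) →
      ∃ x, x ∈ (Q e).val ∧ x ∈ (Q f).val) :
    ∃ σ : Equiv.Perm (Fin n), ∀ e, (Q e).val = Sym2.map σ e.val := by
  have hstar : ∀ v : Fin n, ∃ w, ∀ e, v ∈ e.val → w ∈ (Q e).val := by
    intro v
    obtain ⟨w, hw⟩ := exists_common_vertex_of_four_le_card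
      ((edgeStar v).map (Q.toEmbedding.trans (Function.Embedding.subtype _)))
      (by
        intro a ha b hb hab
        obtain ⟨e, he, rfl⟩ := Finset.mem_map.1 ha
        obtain ⟨f, hf, rfl⟩ := Finset.mem_map.1 hb
        exact hQ e f (by rintro rfl; exact hab rfl) ⟨v, mem_edgeStar.1 he, mem_edgeStar.1 hf⟩)
      (by rw [Finset.card_map, card_edgeStar]; omega)
    exact ⟨w, fun e he => hw _ (Finset.mem_map_of_mem _ (mem_edgeStar.2 he))⟩
  choose τ hτ using hstar
  have himage : ∀ v, (edgeStar v).map Q.toEmbedding = edgeStar (τ v) := by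
    intro v
    refine Finset.eq_of_subset_of_card_le ?_ (by simp [card_edgeStar])
    intro a ha
    obtain ⟨e, he, rfl⟩ := Finset.mem_map.1 ha
    exact mem_edgeStar.2 (hτ v e (mem_edgeStar.1 he))
  have hinj : Function.Injective τ := by
    intro v w hvw
    by_contra hne
    have hs : edgeStar v = edgeStar w :=
      Finset.map_injective Q.toEmbedding (by rw [himage, himage, hvw])
    obtain ⟨u, hu⟩ := Finset.exists_mem_notMem_of_card_lt_card
      (s := {v, w}) (t := Finset.univ) (by
        rw [Finset.card_univ, Fintype.card_fin]
        exact Finset.card_le_two.trans_lt (by omega))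
    simp only [Finset.mem_univ, Finset.mem_insert, Finset.mem_singleton, not_or, true_and] at hu
    have hmem : (⟨s(v, u), by simpa using Ne.symm hu.1⟩ :
        {e : Sym2 (Fin n) // ¬ e.IsDiag}) ∈ edgeStar v := mem_edgeStar.2 (by simp)
    rw [hs, mem_edgeStar, Sym2.mem_iff] at hmem
    rcases hmem with h | h
    · exact hne h.symm
    · exact hu.2 h.symm
  refine ⟨Equiv.ofBijective τ hinj.bijective_of_finite, ?_⟩
  rintro ⟨e, he⟩
  induction e with | _ a b =>
  have hab : a ≠ b := by simpa using he
  exact (Sym2.mem_and_mem_iff (hinj.ne hab)).1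
    ⟨hτ a ⟨s(a, b), he⟩ (by simp), hτ b ⟨s(a, b), he⟩ (by simp)⟩


/-- For `n ≥ 8`, the subgroup `G` of permutations of the edge set of the complete graph
`K_n` induced by permutations of the vertices is self-normalizing in the full permutation
group of the edge set: if `P⁻¹ g P ∈ G` for all `g ∈ G`, then `P ∈ G`. -/
theorem edge_perm_normalizer_eq (n : ℕ) (hn : 8 ≤ n)
    (P : Equiv.Perm {e : Sym2 (Fin n) // ¬ e.IsDiag})
    (hP : ∀ g : Equiv.Perm {e : Sym2 (Fin n) // ¬ e.IsDiag},
      (∃ σ : Equiv.Perm (Fin n),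
        ∀ e : {e : Sym2 (Fin n) // ¬ e.IsDiag}, (g e).val = Sym2.map σ e.val) →
      ∃ τ : Equiv.Perm (Fin n),
        ∀ e : {e : Sym2 (Fin n) // ¬ e.IsDiag},
          ((P⁻¹ * g * P) e).val = Sym2.map τ e.val) :
    ∃ σ : Equiv.Perm (Fin n),
      ∀ e : {e : Sym2 (Fin n) // ¬ e.IsDiag}, (P e).val = Sym2.map σ e.val := by
  have hequiv : ∀ σ : Equiv.Perm (Fin n), ∃ τ : Equiv.Perm (Fin n), ∀ e,
      (P⁻¹ (edgePermOfVertexPerm σ e)).val = Sym2.map τ (P⁻¹ e).val := by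
    intro σ
    obtain ⟨τ, hτ⟩ := hP (edgePermOfVertexPerm σ) ⟨σ, edgePermOfVertexPerm_val σ⟩
    exact ⟨τ, fun e => by simpa using hτ (P⁻¹ e)⟩
  obtain ⟨e₀, f₀, hne₀, hmeet₀, x, hxe, hxf⟩ :=
    exists_intersecting_pair_image_intersecting (by omega) P⁻¹
  obtain ⟨σ, hσ⟩ := exists_vertexPerm_of_preserves_intersecting (by omega) P⁻¹ (by
    intro e f hne hmeet
    obtain ⟨σ, hσe, hσf⟩ := exists_perm_map_intersecting_pair e₀.2 f₀.2
      (Subtype.val_injective.ne hne₀) hmeet₀ e.2 f.2 (Subtype.val_injective.ne hne) hmeet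
    obtain rfl : edgePermOfVertexPerm σ e₀ = e := Subtype.ext hσe
    obtain rfl : edgePermOfVertexPerm σ f₀ = f := Subtype.ext hσf
    obtain ⟨τ, hτ⟩ := hequiv σ
    exact ⟨τ x, hτ e₀ ▸ Sym2.mem_map.2 ⟨x, hxe, rfl⟩, hτ f₀ ▸ Sym2.mem_map.2 ⟨x, hxf, rfl⟩⟩)
  refine ⟨σ⁻¹, fun e => ?_⟩
  have he := hσ (P e)
  rw [Equiv.Perm.coe_inv, Equiv.symm_apply_apply] at he
  rw [he, Sym2.map_map, ← Equiv.Perm.coe_mul, inv_mul_cancel, Equiv.Perm.coe_one, Sym2.map_id, id]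
end
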